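/- Let u and B be as in the context, and let ν denote the positive Radon measure Δu + λ_a u on D. There exist constants C₁, C₂, r₀ > 0 such that for every ball B(x₀,r) ⊂ B with x₀ ∈ ∂Ω_u and r ≤ r₀: C₁ r^{d−1} ≤ ν(B(x₀,r)) ≤ C₂ r^{d−1}. -/

import Mathlib

open MeasureTheory Filter Metric Set
open scoped RealInnerProductSpace ENNReal Topology NNReal

noncomputable section

abbrev Euc (d : ℕ) := EuclideanSpace ℝ (Fin d)

variable {d : ℕ}

/-- Real-valued Lebesgue volume of a set. -/
def mvol (s : Set (Euc d)) : ℝ := (volume s).toReal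

/-- Smooth scalar test function compactly supported in `Ω`. -/
def TestFun (Ω : Set (Euc d)) (φ : Euc d → ℝ) : Prop :=
  ContDiff ℝ (⊤ : ℕ∞) φ ∧ HasCompactSupport φ ∧ tsupport φ ⊆ Ω

/-- Smooth vector field compactly supported in `Ω`. -/
def VecTestFun (Ω : Set (Euc d)) (Φ : Euc d → Euc d) : Prop :=
  ContDiff ℝ (⊤ : ℕ∞) Φ ∧ HasCompactSupport Φ ∧ tsupport Φ ⊆ Ω

/-- Membership in `H¹₀(Ω)`, encoded through `L²` integrability of the function and of its
(a.e. defined) gradient, together with approximation in the `H¹` norm by smooth functions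
compactly supported in `Ω`. -/
def MemH10 (Ω : Set (Euc d)) (v : Euc d → ℝ) : Prop :=
  MemLp v 2 (volume : Measure (Euc d)) ∧
  MemLp (fun x => gradient v x) 2 (volume : Measure (Euc d)) ∧
  ∃ φ : ℕ → Euc d → ℝ, (∀ n, TestFun Ω (φ n)) ∧
    Tendsto (fun n => ∫ x, ((v x - φ n x) ^ 2 + ‖gradient v x - gradient (φ n) x‖ ^ 2))
      atTop (nhds 0)

/-- First Dirichlet eigenvalue of `Ω`, via the Rayleigh quotient variational characterization. -/
def lam1 (Ω : Set (Euc d)) : ℝ :=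
  sInf {t : ℝ | ∃ v : Euc d → ℝ, MemH10 Ω v ∧ (∫ x, (v x) ^ 2) = 1 ∧
    t = ∫ x, ‖gradient v x‖ ^ 2}

/-- `u` is a normalized first Dirichlet eigenfunction of `Ω`. -/
def IsFirstEigenfun (Ω : Set (Euc d)) (u : Euc d → ℝ) : Prop :=
  MemH10 Ω u ∧ (∫ x, (u x) ^ 2) = 1 ∧ (∫ x, ‖gradient u x‖ ^ 2) = lam1 Ω ∧
  ∀ φ : Euc d → ℝ, TestFun Ω φ →
    (∫ x, ⟪gradient u x, gradient φ x⟫) = lam1 Ω * ∫ x, u x * φ x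

/-- `Ω` solves the shape optimization problem: it minimizes `λ₁` among open subsets of `D` of
measure `a`. -/
structure IsOptimalShape (D : Set (Euc d)) (a : ℝ) (Ω : Set (Euc d)) : Prop where
  isOpen : IsOpen Ω
  subset : Ω ⊆ D
  meas : mvol Ω = a
  minim : ∀ Ω' : Set (Euc d), IsOpen Ω' → Ω' ⊆ D → mvol Ω' = a → lam1 Ω ≤ lam1 Ω'

/-- `u` is locally Lipschitz continuous in `s`. -/
def LocLipOn (s : Set (Euc d)) (u : Euc d → ℝ) : Prop :=
  ∀ x ∈ s, ∃ t, t ∈ 𝓝 x ∧ t ⊆ s ∧ ∃ K : ℝ≥0, LipschitzOnWith K u t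

/-- Divergence of a vector field. -/
def divg (Φ : Euc d → Euc d) (x : Euc d) : ℝ :=
  ∑ i, fderiv ℝ Φ x (EuclideanSpace.single i 1) i

/-- `Ω` has locally finite perimeter in `D` (its characteristic function has locally bounded
variation in `D`). -/
def HasLocFinPerimeterIn (D Ω : Set (Euc d)) : Prop :=
  ∀ K : Set (Euc d), IsCompact K → K ⊆ D → ∃ C : ℝ,
    ∀ Φ : Euc d → Euc d, VecTestFun K Φ → (∀ x, ‖Φ x‖ ≤ 1) →
      (∫ x in Ω, divg Φ x) ≤ C

/-- The reduced boundary of `Ω`: points where `Ω` blows up to a half space, in the sense that the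
symmetric difference with a half space is of vanishing density. -/
def reducedBoundary (Ω : Set (Euc d)) : Set (Euc d) :=
  {x | ∃ ν : Euc d, ‖ν‖ = 1 ∧
    Tendsto (fun r : ℝ =>
        volume (symmDiff (Ω ∩ ball x r) ({y | ⟪y - x, ν⟫ ≤ 0} ∩ ball x r)) /
          ENNReal.ofReal (r ^ d))
      (𝓝[>] 0) (𝓝 0)}

/-- `S` is an analytic hypersurface in `D`: near each of its points in `D` it is the zero set of
an analytic function with nonvanishing gradient. -/
def IsAnalyticHypersurfaceIn (D S : Set (Euc d)) : Prop :=
  ∀ x ∈ S ∩ D, ∃ U : Set (Euc d), IsOpen U ∧ x ∈ U ∧ U ⊆ D ∧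
    ∃ f : Euc d → ℝ, AnalyticOn ℝ f U ∧ (∀ y ∈ U, fderiv ℝ f y ≠ 0) ∧
      S ∩ U = {y ∈ U | f y = 0}

/-- The functional `J(v) = ∫ |∇v|² - λ ∫ v²`. -/
def Jfun (lam : ℝ) (v : Euc d → ℝ) : ℝ :=
  (∫ x, ‖gradient v x‖ ^ 2) - lam * ∫ x, (v x) ^ 2

/-- `Ω_v = {x ∈ D : v(x) ≠ 0}`. -/
def Om (D : Set (Euc d)) (v : Euc d → ℝ) : Set (Euc d) := {x ∈ D | v x ≠ 0}

/-- The optimal value `λ_a` of `λ₁` among open subsets of `D` of measure `a`. -/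
def lamOpt (D : Set (Euc d)) (a : ℝ) : ℝ :=
  sInf {t : ℝ | ∃ Ω : Set (Euc d), IsOpen Ω ∧ Ω ⊆ D ∧ mvol Ω = a ∧ t = lam1 Ω}

/-- `u` minimizes `J` among functions of `H¹₀(D)` with `|Ω_w| ≤ a`. -/
def IsJMinimizer (D : Set (Euc d)) (a lam : ℝ) (u : Euc d → ℝ) : Prop :=
  MemH10 D u ∧ mvol (Om D u) ≤ a ∧
  ∀ w : Euc d → ℝ, MemH10 D w → mvol (Om D w) ≤ a → Jfun lam u ≤ Jfun lam w

/-- The class `F` of perturbations of `u` supported in `B`. -/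
def Fcal (D B : Set (Euc d)) (u v : Euc d → ℝ) : Prop :=
  MemH10 D v ∧ MemH10 B (fun x => u x - v x)

/-- The set of penalization constants `μ₋` admissible for `h` (inward perturbations). -/
def Mminus (D : Set (Euc d)) (a lam : ℝ) (u : Euc d → ℝ) (B : Set (Euc d)) (h : ℝ) :
    Set ℝ :=
  {μ : ℝ | 0 ≤ μ ∧ ∀ v : Euc d → ℝ, Fcal D B u v →
    a - h ≤ mvol (Om D v) → mvol (Om D v) ≤ a →
    Jfun lam u + μ * mvol (Om D u) ≤ Jfun lam v + μ * mvol (Om D v)}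

/-- The set of penalization constants `μ₊` admissible for `h` (outward perturbations). -/
def Mplus (D : Set (Euc d)) (a lam : ℝ) (u : Euc d → ℝ) (B : Set (Euc d)) (h : ℝ) :
    Set ℝ :=
  {μ : ℝ | 0 ≤ μ ∧ ∀ v : Euc d → ℝ, Fcal D B u v →
    a ≤ mvol (Om D v) → mvol (Om D v) ≤ a + h →
    Jfun lam u + μ * mvol (Om D u) ≤ Jfun lam v + μ * mvol (Om D v)}

/-- `μ₋(h)`: the biggest admissible inward penalization constant. -/
def muMinus (D : Set (Euc d)) (a lam : ℝ) (u : Euc d → ℝ) (B : Set (Euc d)) (h : ℝ) : ℝ :=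
  sSup (Mminus D a lam u B h)

/-- `μ₊(h)`: the smallest admissible outward penalization constant. -/
def muPlus (D : Set (Euc d)) (a lam : ℝ) (u : Euc d → ℝ) (B : Set (Euc d)) (h : ℝ) : ℝ :=
  sInf (Mplus D a lam u B h)

/-- Average of `u` on the sphere `∂B(x,r)`, with respect to the `(d-1)`-Hausdorff measure. -/
def sphAvg (u : Euc d → ℝ) (x : Euc d) (r : ℝ) : ℝ :=
  (∫ y in sphere x r, u y ∂(μH[(d : ℝ) - 1])) / ((μH[(d : ℝ) - 1]) (sphere x r)).toReal

section part1

lemma lip_on_compact {D : Set (Euc d)} {u : Euc d → ℝ} (hlip : LocLipOn D u) {S : Set (Euc d)}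
    (hS : IsCompact S) (hSD : S ⊆ D) : ∃ K : ℝ≥0, LipschitzOnWith K u S := by
  apply LocallyLipschitzOn.exists_lipschitzOnWith_of_compact hS
  intro x hx
  obtain ⟨t, ht, _, K, hK⟩ := hlip x (hSD hx)
  exact ⟨K, t, mem_nhdsWithin_of_mem_nhds ht, hK⟩

lemma locLip_contOn {D : Set (Euc d)} {u : Euc d → ℝ} (hlip : LocLipOn D u) : ContinuousOn u D := by
  intro x hx
  obtain ⟨t, ht, _, K, hK⟩ := hlip x hx
  exact (hK.continuousOn.continuousAt ht).continuousWithinAt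

lemma norm_gradient_eq (f : Euc d → ℝ) (x : Euc d) : ‖gradient f x‖ = ‖fderiv ℝ f x‖ := by
  simp [gradient]

lemma norm_gradient_le {g : Euc d → ℝ} {K : ℝ≥0} (hg : LipschitzWith K g) (x : Euc d) :
    ‖gradient g x‖ ≤ K := by
  rw [norm_gradient_eq]; exact norm_fderiv_le_of_lipschitz ℝ hg

lemma measurable_gradient (f : Euc d → ℝ) : Measurable (fun x => gradient f x) := by
  have := measurable_fderiv ℝ f
  exact (InnerProductSpace.toDual ℝ (Euc d)).symm.continuous.measurable.comp this

lemma gradient_zero_off {g : Euc d → ℝ} {x : Euc d} (hx : x ∉ tsupport g) : gradient g x = 0 := by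
  have : fderiv ℝ g x = 0 := by
    by_contra h
    exact hx (support_fderiv_subset ℝ (by simpa using h))
  simp [gradient, this]

lemma gradient_sub' {f g : Euc d → ℝ} {x : Euc d} (hf : DifferentiableAt ℝ f x)
    (hg : DifferentiableAt ℝ g x) :
    gradient (fun y => f y - g y) x = gradient f x - gradient g x := by
  simp only [gradient]
  rw [fderiv_fun_sub hf hg, map_sub]

/-- Approximation of Lipschitz functions by test functions. -/
lemma lip_approx {U : Set (Euc d)} (hU : IsOpen U) {g : Euc d → ℝ} {K : ℝ≥0}
    (hg : LipschitzWith K g) (hgc : HasCompactSupport g) (hgU : tsupport g ⊆ U) :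
    ∃ (φ : ℕ → Euc d → ℝ) (S : Set (Euc d)) (M : ℝ), IsCompact S ∧ S ⊆ U ∧
      (∀ n, TestFun U (φ n)) ∧ (∀ n, tsupport (φ n) ⊆ S) ∧ tsupport g ⊆ S ∧
      (∀ n x, |φ n x| ≤ M) ∧ (∀ x, |g x| ≤ M) ∧
      (∀ x, Tendsto (fun n => φ n x) atTop (𝓝 (g x))) ∧
      (∀ n x, ‖gradient (φ n) x‖ ≤ K) ∧
      (∀ᵐ x, Tendsto (fun n => gradient (φ n) x) atTop (𝓝 (gradient g x))) := by
  obtain ⟨δ, hδ, hδU⟩ := hgc.isCompact.exists_cthickening_subset_open hU hgU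
  obtain ⟨M, hM⟩ := hg.continuous.bounded_above_of_compact_support hgc
  let ρ : ℕ → ContDiffBump (0 : Euc d) := fun n =>
    ⟨δ / (n + 3), 2 * (δ / (n + 3)), by positivity, by
      have : 0 < δ / ((n : ℝ) + 3) := by positivity
      linarith⟩
  have hρout : ∀ n, (ρ n).rOut = 2 * (δ / ((n : ℝ) + 3)) := fun n => rfl
  have hρin : ∀ n, (ρ n).rIn = (δ / ((n : ℝ) + 3)) := fun n => rfl
  have hρlim : Tendsto (fun n => (ρ n).rOut) atTop (𝓝 0) := by
    simp only [hρout]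
    have h1 : Tendsto (fun n : ℕ => (n : ℝ) + 3) atTop atTop :=
      tendsto_atTop_add_const_right _ _ tendsto_natCast_atTop_atTop
    have := (h1.const_div_atTop δ).const_mul 2
    simpa using this
  have hρδ : ∀ n, (ρ n).rOut ≤ δ := by
    intro n
    rw [hρout]
    rw [← mul_div_assoc, div_le_iff₀ (by positivity)]
    have : (0 : ℝ) ≤ n := by positivity
    nlinarith
  let φ : ℕ → Euc d → ℝ := fun n x => ∫ t, (ρ n).normed volume t * g (x - t)
  have hφconv : ∀ n, φ n = convolution ((ρ n).normed volume) g (ContinuousLinearMap.lsmul ℝ ℝ) volume := by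
    intro n; ext x; simp [φ, convolution, smul_eq_mul]
  have hint1 : ∀ n, ∫ t, (ρ n).normed volume t = 1 := fun n => (ρ n).integral_normed
  have hintg : ∀ n, Integrable (fun t => (ρ n).normed volume t) := fun n => (ρ n).integrable_normed
  have hnn : ∀ n t, 0 ≤ (ρ n).normed volume t := fun n t => (ρ n).nonneg_normed t
  -- support
  have hsupp : ∀ n, tsupport (φ n) ⊆ cthickening δ (tsupport g) := by
    intro n
    refine closure_minimal ?_ isClosed_cthickening
    intro x hx
    by_contra hxn
    apply hx
    have : ∀ t, (ρ n).normed volume t * g (x - t) = 0 := by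
      intro t
      by_cases ht : t ∈ ball (0 : Euc d) (ρ n).rOut
      · have : g (x - t) = 0 := by
          by_contra hne
          apply hxn
          refine mem_cthickening_of_dist_le x (x - t) δ _ (subset_tsupport g hne) ?_
          simp only [dist_eq_norm, sub_sub_cancel]
          have := mem_ball_zero_iff.1 ht
          linarith [hρδ n]
        simp [this]
      · have : (ρ n).normed volume t = 0 := by
          by_contra hne
          apply ht
          have := (ρ n).support_normed_eq (μ := volume)
          rw [← this]; exact hne
        simp [this]
    simp [φ, this]
  -- gradient
  have hder : ∀ n x, HasFDerivAt (φ n) (∫ t, (ρ n).normed volume t • fderiv ℝ g (x - t)) x := by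
    intro n x
    have hmp : Measure.QuasiMeasurePreserving (fun t : Euc d => x - t) volume volume :=
      quasiMeasurePreserving_sub_left_of_right_invariant volume x
    refine (hasFDerivAt_integral_of_dominated_loc_of_lip
      (bound := fun t => K * (ρ n).normed volume t)
      (F := fun x t => (ρ n).normed volume t * g (x - t)) univ_mem ?_ ?_ ?_ ?_ ?_ ?_).2
    · refine Eventually.of_forall fun y => ?_
      exact ((ρ n).continuous_normed.mul (hg.continuous.comp (by fun_prop))).aestronglyMeasurable
    · refine Integrable.mono' ((hintg n).mul_const M) ?_ ?_
      · exact ((ρ n).continuous_normed.mul (hg.continuous.comp (by fun_prop))).aestronglyMeasurable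
      · refine Eventually.of_forall fun t => ?_
        rw [norm_mul, Real.norm_of_nonneg (hnn n t)]
        exact mul_le_mul_of_nonneg_left (hM _) (hnn n t)
    · refine ((ρ n).continuous_normed.aestronglyMeasurable).smul ?_
      have : Measurable (fun t : Euc d => fderiv ℝ g (x - t)) :=
        (measurable_fderiv ℝ g).comp (by fun_prop)
      exact this.aestronglyMeasurable
    · refine Eventually.of_forall fun t => ?_
      refine LipschitzOnWith.of_dist_le_mul fun y _ z _ => ?_
      have h1 := hg.dist_le_mul (y - t) (z - t)
      rw [Real.coe_nnabs, abs_of_nonneg (mul_nonneg K.coe_nonneg (hnn n t))]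
      simp only [Real.dist_eq, ← mul_sub, abs_mul, abs_of_nonneg (hnn n t)] at h1 ⊢
      simp only [dist_sub_right] at h1
      nlinarith [hnn n t, mul_le_mul_of_nonneg_left h1 (hnn n t)]
    · exact (hintg n).const_mul _
    · have := hmp.ae hg.ae_differentiableAt
      filter_upwards [this] with t ht
      have h1 : HasFDerivAt (fun y => g (y - t)) (fderiv ℝ g (x - t)) x := by
        exact (hasFDerivAt_comp_sub t).2 ht.hasFDerivAt
      exact h1.const_mul _
  refine ⟨φ, cthickening δ (tsupport g), M, hgc.isCompact.cthickening, hδU, ?_, hsupp,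
    self_subset_cthickening _, ?_, fun x => hM x, ?_, ?_, ?_⟩
  · intro n
    refine ⟨?_, ?_, (hsupp n).trans hδU⟩
    · rw [hφconv]
      exact HasCompactSupport.contDiff_convolution_left _ (ρ n).hasCompactSupport_normed
        ((ρ n).contDiff_normed) hg.continuous.locallyIntegrable
    · exact HasCompactSupport.of_support_subset_isCompact hgc.isCompact.cthickening
        ((subset_tsupport _).trans (hsupp n))
  · intro n x
    rw [← Real.norm_eq_abs]
    calc ‖φ n x‖ ≤ ∫ t, M * (ρ n).normed volume t := by
          refine norm_integral_le_of_norm_le ((hintg n).const_mul M) (Eventually.of_forall fun t => ?_)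
          rw [norm_mul, Real.norm_of_nonneg (hnn n t), mul_comm]
          exact mul_le_mul_of_nonneg_right (hM _) (hnn n t)
      _ = M := by rw [integral_const_mul, hint1, mul_one]
  · intro x
    simp_rw [hφconv]
    exact ContDiffBump.convolution_tendsto_right_of_continuous hρlim hg.continuous x
  · intro n x
    rw [norm_gradient_eq, (hder n x).fderiv]
    calc _ ≤ ∫ t, (K : ℝ) * (ρ n).normed volume t := by
          refine norm_integral_le_of_norm_le ((hintg n).const_mul _) (Eventually.of_forall fun t => ?_)
          rw [norm_smul, Real.norm_of_nonneg (hnn n t), mul_comm]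
          exact mul_le_mul_of_nonneg_right (norm_fderiv_le_of_lipschitz ℝ hg) (hnn n t)
      _ = K := by rw [integral_const_mul, hint1, mul_one]
  · have hli : LocallyIntegrable (fderiv ℝ g) (volume : Measure (Euc d)) := by
      refine (locallyIntegrable_const (K : ℝ)).mono (measurable_fderiv ℝ g).aestronglyMeasurable ?_
      refine Eventually.of_forall fun t => ?_
      rw [Real.norm_of_nonneg K.coe_nonneg]
      exact norm_fderiv_le_of_lipschitz ℝ hg
    have := ContDiffBump.ae_convolution_tendsto_right_of_locallyIntegrable (K := 2) hρlim
      (Eventually.of_forall fun n => by rw [hρout, hρin]) hli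
    filter_upwards [this] with x hx
    have h2 : Tendsto (fun n => fderiv ℝ (φ n) x) atTop (𝓝 (fderiv ℝ g x)) := by
      refine hx.congr fun n => ?_
      rw [(hder n x).fderiv]
      simp [convolution]
    simp only [gradient]
    exact ((InnerProductSpace.toDual ℝ (Euc d)).symm.continuous.tendsto _).comp h2

end part1

section part2

/-- The weak form of `Δu + lam u`. -/
def Nf (lam : ℝ) (u g : Euc d → ℝ) : ℝ :=
  lam * (∫ x, u x * g x) - ∫ x, ⟪gradient u x, gradient g x⟫

lemma memLp_of_bdd_supp {E : Type*} [NormedAddCommGroup E] {F : Euc d → E} {S : Set (Euc d)}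
    (hS : IsCompact S)
    (hF : AEStronglyMeasurable F volume) {C : ℝ} (hC : ∀ x, ‖F x‖ ≤ C) (h0 : ∀ x, x ∉ S → F x = 0)
    (p : ℝ≥0∞) : MemLp F p (volume : Measure (Euc d)) := by
  have h1 : F = S.indicator F := by
    ext x
    by_cases hx : x ∈ S
    · simp [hx]
    · simp [hx, h0 x hx]
  rw [h1, memLp_indicator_iff_restrict hS.measurableSet]
  haveI : IsFiniteMeasure (volume.restrict S) := ⟨by
    rw [Measure.restrict_apply_univ]; exact hS.measure_lt_top⟩
  exact MemLp.of_bound hF.restrict C (Eventually.of_forall hC)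

lemma memLp_grad {g : Euc d → ℝ} {K : ℝ≥0}
    (hg : LipschitzWith K g) (hgc : HasCompactSupport g) (p : ℝ≥0∞) :
    MemLp (fun x => gradient g x) p (volume : Measure (Euc d)) :=
  memLp_of_bdd_supp hgc.isCompact (measurable_gradient g).aestronglyMeasurable
    (norm_gradient_le hg) (fun _ hx => gradient_zero_off hx) p

lemma memLp_lip {g : Euc d → ℝ} {K : ℝ≥0}
    (hg : LipschitzWith K g) (hgc : HasCompactSupport g) (p : ℝ≥0∞) :
    MemLp g p (volume : Measure (Euc d)) :=
  hg.continuous.memLp_of_hasCompactSupport hgc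

lemma testFun_lip {U : Set (Euc d)} {φ : Euc d → ℝ} (h : TestFun U φ) :
    ∃ K, LipschitzWith K φ :=
  ContDiff.lipschitzWith_of_hasCompactSupport h.2.1 h.1 (by simp)

/-- convergence in `H¹` from the output of `lip_approx` -/
lemma tendsto_H1 {g : Euc d → ℝ} {φ : ℕ → Euc d → ℝ} {S : Set (Euc d)} {M : ℝ} {K : ℝ≥0}
    (hg : LipschitzWith K g)
    (hS : IsCompact S) (hφ : ∀ n, Continuous (φ n)) (hφS : ∀ n, tsupport (φ n) ⊆ S)
    (hgS : tsupport g ⊆ S) (hφM : ∀ n x, |φ n x| ≤ M) (hgM : ∀ x, |g x| ≤ M)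
    (hlim : ∀ x, Tendsto (fun n => φ n x) atTop (𝓝 (g x)))
    (hφK : ∀ n x, ‖gradient (φ n) x‖ ≤ K)
    (hglim : ∀ᵐ x, Tendsto (fun n => gradient (φ n) x) atTop (𝓝 (gradient g x))) :
    Tendsto (fun n => ∫ x, ((g x - φ n x) ^ 2 + ‖gradient g x - gradient (φ n) x‖ ^ 2))
      atTop (nhds 0) := by
  have hM0 : 0 ≤ M := (abs_nonneg _).trans (hgM 0)
  have h0 : (0 : ℝ) = ∫ x : Euc d, (0 : ℝ) := by simp
  rw [h0]
  refine tendsto_integral_of_dominated_convergence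
    (S.indicator fun _ => (2 * M) ^ 2 + (2 * (K : ℝ)) ^ 2) ?_ ?_ ?_ ?_
  · intro n
    exact (((hg.continuous.sub (hφ n)).pow 2).measurable.add
      (((measurable_gradient g).sub (measurable_gradient (φ n))).norm.pow_const 2)).aestronglyMeasurable
  · rw [integrable_indicator_iff hS.measurableSet]
    exact integrableOn_const hS.measure_lt_top.ne
  · intro n
    refine Eventually.of_forall fun x => ?_
    by_cases hx : x ∈ S
    · rw [indicator_of_mem hx, Real.norm_of_nonneg (by positivity)]
      have h1 : |g x - φ n x| ≤ 2 * M := by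
        have := abs_sub (g x) (φ n x)
        linarith [hgM x, hφM n x]
      have h2 : ‖gradient g x - gradient (φ n) x‖ ≤ 2 * K := by
        have := norm_sub_le (gradient g x) (gradient (φ n) x)
        linarith [norm_gradient_le hg x, hφK n x]
      rw [← sq_abs (g x - φ n x)]
      gcongr
    · rw [indicator_of_notMem hx]
      have a1 : x ∉ tsupport g := fun h => hx (hgS h)
      have a2 : x ∉ tsupport (φ n) := fun h => hx (hφS n h)
      simp [gradient_zero_off a1, gradient_zero_off a2, image_eq_zero_of_notMem_tsupport a1,
        image_eq_zero_of_notMem_tsupport a2]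
  · filter_upwards [hglim] with x hx
    have h1 : Tendsto (fun n => (g x - φ n x) ^ 2) atTop (𝓝 ((g x - g x) ^ 2)) :=
      ((hlim x).const_sub _).pow 2
    have h2 : Tendsto (fun n => ‖gradient g x - gradient (φ n) x‖ ^ 2) atTop
        (𝓝 (‖gradient g x - gradient g x‖ ^ 2)) := ((hx.const_sub _).norm).pow 2
    simpa using h1.add h2

lemma memH10_lip {U : Set (Euc d)} (hU : IsOpen U) {g : Euc d → ℝ} {K : ℝ≥0}
    (hg : LipschitzWith K g) (hgc : HasCompactSupport g) (hgU : tsupport g ⊆ U) : MemH10 U g := by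
  obtain ⟨φ, S, M, hS, hSU, hφ, hφS, hgS, hφM, hgM, hlim, hφK, hglim⟩ := lip_approx hU hg hgc hgU
  exact ⟨memLp_lip hg hgc 2, memLp_grad hg hgc 2, φ, hφ,
    tendsto_H1 hg hS (fun n => (hφ n).1.continuous) hφS hgS hφM hgM hlim hφK hglim⟩

lemma ae_diff {D : Set (Euc d)} {u : Euc d → ℝ} (hlip : LocLipOn D u) :
    ∀ᵐ x : Euc d, x ∈ D → DifferentiableAt ℝ u x := by
  rw [ae_iff]
  refine measure_null_of_locally_null _ fun x hx => ?_
  simp only [mem_setOf_eq, Classical.not_imp] at hx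
  obtain ⟨t, ht, _, K, hK⟩ := hlip x hx.1
  refine ⟨interior t ∩ {x | ¬ (x ∈ D → DifferentiableAt ℝ u x)}, ?_, ?_⟩
  · exact inter_mem (mem_nhdsWithin_of_mem_nhds (interior_mem_nhds.2 ht)) self_mem_nhdsWithin
  · have := hK.ae_differentiableWithinAt_of_mem (μ := volume)
    rw [ae_iff] at this
    refine measure_mono_null ?_ this
    rintro y ⟨hy1, hy2⟩
    simp only [mem_setOf_eq, Classical.not_imp] at hy2 ⊢
    exact ⟨interior_subset hy1, fun h => hy2.2 (h.differentiableAt (mem_interior_iff_mem_nhds.1 hy1))⟩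

lemma ae_grad_sub {D : Set (Euc d)} {u : Euc d → ℝ} (hlip : LocLipOn D u) {g : Euc d → ℝ}
    {K : ℝ≥0} (hg : LipschitzWith K g) (hgD : tsupport g ⊆ D) :
    ∀ᵐ x : Euc d, gradient (fun y => u y - g y) x = gradient u x - gradient g x := by
  filter_upwards [ae_diff hlip, hg.ae_differentiableAt] with x h1 h2
  by_cases hx : x ∈ D
  · exact gradient_sub' (h1 hx) h2
  · have hx' : x ∉ tsupport g := fun h => hx (hgD h)
    rw [gradient_zero_off hx', sub_zero]
    apply Filter.EventuallyEq.gradient_eq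
    filter_upwards [(isClosed_tsupport g).isOpen_compl.mem_nhds hx'] with y hy
    simp [image_eq_zero_of_notMem_tsupport hy]

lemma memH10_sub {D : Set (Euc d)} (hD : IsOpen D) {u : Euc d → ℝ} (hu : MemH10 D u)
    (hlip : LocLipOn D u) {g : Euc d → ℝ}
    {K : ℝ≥0} (hg : LipschitzWith K g) (hgc : HasCompactSupport g) (hgD : tsupport g ⊆ D) :
    MemH10 D (fun x => u x - g x) := by
  have hae := ae_grad_sub hlip hg hgD
  obtain ⟨hg1, hg2, ψ, hψ, hψl⟩ := memH10_lip hD hg hgc hgD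
  obtain ⟨hu1, hu2, φ, hφ, hφl⟩ := hu
  have hv2 : MemLp (fun x => gradient (fun y => u y - g y) x) 2 (volume : Measure (Euc d)) :=
    (memLp_congr_ae hae).2 (hu2.sub hg2)
  refine ⟨hu1.sub hg1, hv2, fun n x => φ n x - ψ n x, ?_, ?_⟩
  · intro n
    refine ⟨(hφ n).1.sub (hψ n).1, (hφ n).2.1.sub (hψ n).2.1, ?_⟩
    refine (tsupport_sub _ _).trans (union_subset (hφ n).2.2 (hψ n).2.2)
  · have hI : ∀ {f : Euc d → ℝ} {χ : Euc d → ℝ}, MemLp f 2 (volume : Measure (Euc d)) →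
        MemLp (fun x => gradient f x) 2 (volume : Measure (Euc d)) → TestFun D χ →
        Integrable (fun x => (f x - χ x) ^ 2 + ‖gradient f x - gradient χ x‖ ^ 2) := by
      intro f χ h1 h2 h3
      obtain ⟨Kχ, hKχ⟩ := testFun_lip h3
      exact ((h1.sub (memLp_lip hKχ h3.2.1 2)).integrable_sq).add
        ((h2.sub (memLp_grad hKχ h3.2.1 2)).integrable_norm_pow (by norm_num))
    have h3 := (hφl.add hψl).const_mul 2
    simp only [add_zero, mul_zero] at h3
    refine squeeze_zero (fun n => integral_nonneg fun x => by positivity) (fun n => ?_) h3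
    rw [← integral_add (hI hu1 hu2 (hφ n)) (hI hg1 hg2 (hψ n)), ← integral_const_mul]
    refine integral_mono_of_nonneg (Eventually.of_forall fun x => by positivity)
      (((hI hu1 hu2 (hφ n)).add (hI hg1 hg2 (hψ n))).const_mul 2) ?_
    filter_upwards [hae] with x hx
    have h4 : gradient (fun y => φ n y - ψ n y) x = gradient (φ n) x - gradient (ψ n) x :=
      gradient_sub' ((hφ n).1.differentiable (by simp) x) ((hψ n).1.differentiable (by simp) x)
    have hx' : gradient (fun x => u x - g x) x = gradient u x - gradient g x := hx
    rw [hx', h4]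
    have h5 : gradient u x - gradient g x - (gradient (φ n) x - gradient (ψ n) x)
      = (gradient u x - gradient (φ n) x) - (gradient g x - gradient (ψ n) x) := by abel
    rw [h5]
    have h6 := norm_sub_le (gradient u x - gradient (φ n) x) (gradient g x - gradient (ψ n) x)
    have h7 : ‖(gradient u x - gradient (φ n) x) - (gradient g x - gradient (ψ n) x)‖ ^ 2 ≤
      (‖gradient u x - gradient (φ n) x‖ + ‖gradient g x - gradient (ψ n) x‖) ^ 2 := by gcongr
    have h8 := sq_nonneg (‖gradient u x - gradient (φ n) x‖ - ‖gradient g x - gradient (ψ n) x‖)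
    have h9 := sq_nonneg ((u x - φ n x) + (g x - ψ n x))
    nlinarith

lemma integrable_inner_grad {u g : Euc d → ℝ}
    (hu : MemLp (fun x => gradient u x) 2 (volume : Measure (Euc d)))
    (hg : MemLp (fun x => gradient g x) 2 (volume : Measure (Euc d))) :
    Integrable (fun x => ⟪gradient u x, gradient g x⟫) := by
  have h1 := hu.integrable_norm_pow (p := 2) (by norm_num)
  have h2 := hg.integrable_norm_pow (p := 2) (by norm_num)
  refine (h1.add h2).mono' (hu.1.inner hg.1) (Eventually.of_forall fun x => ?_)
  have := norm_inner_le_norm (𝕜 := ℝ) (gradient u x) (gradient g x)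
  simp only [Pi.add_apply]
  nlinarith [sq_nonneg (‖gradient u x‖ - ‖gradient g x‖), norm_nonneg (gradient u x),
    norm_nonneg (gradient g x)]

lemma J_sub {D : Set (Euc d)} (lam : ℝ) {u : Euc d → ℝ} (hu : MemH10 D u)
    (hlip : LocLipOn D u) {g : Euc d → ℝ}
    {K : ℝ≥0} (hg : LipschitzWith K g) (hgc : HasCompactSupport g) (hgD : tsupport g ⊆ D) :
    Jfun lam (fun x => u x - g x) =
      Jfun lam u + 2 * Nf lam u g + (∫ x, ‖gradient g x‖ ^ 2) - lam * ∫ x, (g x) ^ 2 := by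
  have hae := ae_grad_sub hlip hg hgD
  have hg1 := memLp_lip hg hgc 2
  have hg2 := memLp_grad hg hgc 2
  have e1 : (∫ x, ‖gradient (fun y => u y - g y) x‖ ^ 2) =
      (∫ x, ‖gradient u x‖ ^ 2) - 2 * (∫ x, ⟪gradient u x, gradient g x⟫) +
        ∫ x, ‖gradient g x‖ ^ 2 := by
    rw [← integral_const_mul, ← integral_sub, ← integral_add]
    · refine integral_congr_ae ?_
      filter_upwards [hae] with x hx
      rw [hx, norm_sub_sq_real]
    · exact (hu.2.1.integrable_norm_pow (p := 2) (by norm_num)).sub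
        ((integrable_inner_grad hu.2.1 hg2).const_mul 2)
    · exact hg2.integrable_norm_pow (p := 2) (by norm_num)
    · exact hu.2.1.integrable_norm_pow (p := 2) (by norm_num)
    · exact (integrable_inner_grad hu.2.1 hg2).const_mul 2
  have hug : Integrable (fun x => u x * g x) := hu.1.integrable_mul hg1
  have e2 : (∫ x, (u x - g x) ^ 2) = (∫ x, (u x) ^ 2) - 2 * (∫ x, u x * g x) + ∫ x, (g x) ^ 2 := by
    rw [← integral_const_mul, ← integral_sub, ← integral_add]
    · congr 1; ext x; ring
    · exact (hu.1.integrable_sq).sub (hug.const_mul 2)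
    · exact hg1.integrable_sq
    · exact hu.1.integrable_sq
    · exact hug.const_mul 2
  unfold Jfun Nf
  rw [e1, e2]
  ring

lemma Nf_neg (lam : ℝ) (u g : Euc d → ℝ) : Nf lam u (fun x => - g x) = - Nf lam u g := by
  have : ∀ x, gradient (fun y => - g y) x = - gradient g x := by
    intro x
    simp only [gradient]
    rw [fderiv_fun_neg, map_neg]
  unfold Nf
  simp only [this, inner_neg_right, mul_neg, integral_neg]
  ring

lemma Nf_add (lam : ℝ) {u f g : Euc d → ℝ} {K K' : ℝ≥0}
    (hu : MemLp u 2 (volume : Measure (Euc d)))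
    (hu2 : MemLp (fun x => gradient u x) 2 (volume : Measure (Euc d)))
    (hf : LipschitzWith K f) (hfc : HasCompactSupport f)
    (hg : LipschitzWith K' g) (hgc : HasCompactSupport g) :
    Nf lam u (fun x => f x + g x) = Nf lam u f + Nf lam u g := by
  have h1 : (∫ x, u x * (f x + g x)) = (∫ x, u x * f x) + ∫ x, u x * g x := by
    have i1 : Integrable (fun x => u x * f x) := hu.integrable_mul (memLp_lip hf hfc 2)
    have i2 : Integrable (fun x => u x * g x) := hu.integrable_mul (memLp_lip hg hgc 2)
    rw [← integral_add i1 i2]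
    simp only [mul_add]
  have h2 : (∫ x, ⟪gradient u x, gradient (fun x => f x + g x) x⟫) =
      (∫ x, ⟪gradient u x, gradient f x⟫) + ∫ x, ⟪gradient u x, gradient g x⟫ := by
    rw [← integral_add (integrable_inner_grad hu2 (memLp_grad hf hfc 2))
      (integrable_inner_grad hu2 (memLp_grad hg hgc 2))]
    refine integral_congr_ae ?_
    filter_upwards [hf.ae_differentiableAt, hg.ae_differentiableAt] with x hx hx'
    have : gradient (fun x => f x + g x) x = gradient f x + gradient g x := by
      simp only [gradient]; rw [fderiv_fun_add hx hx', map_add]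
    rw [this, inner_add_right]
  unfold Nf
  rw [h1, h2]; ring

lemma Nf_tendsto (lam : ℝ) {u g : Euc d → ℝ} {φ : ℕ → Euc d → ℝ} {S : Set (Euc d)} {M : ℝ} {K : ℝ≥0}
    (hu : MemLp u 2 (volume : Measure (Euc d)))
    (hu2 : MemLp (fun x => gradient u x) 2 (volume : Measure (Euc d)))
    (hS : IsCompact S) (hφ : ∀ n, Continuous (φ n)) (hφS : ∀ n, tsupport (φ n) ⊆ S)
    (hφM : ∀ n x, |φ n x| ≤ M)
    (hlim : ∀ x, Tendsto (fun n => φ n x) atTop (𝓝 (g x)))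
    (hφK : ∀ n x, ‖gradient (φ n) x‖ ≤ K)
    (hglim : ∀ᵐ x, Tendsto (fun n => gradient (φ n) x) atTop (𝓝 (gradient g x))) :
    Tendsto (fun n => Nf lam u (φ n)) atTop (𝓝 (Nf lam u g)) := by
  have hI : ∀ {E : Type} [NormedAddCommGroup E] {F : Euc d → E}, MemLp F 2 (volume : Measure (Euc d)) →
      ∀ C : ℝ, Integrable (S.indicator fun x => ‖F x‖ * C) := by
    intro E _ F hF C
    rw [integrable_indicator_iff hS.measurableSet]
    haveI : IsFiniteMeasure (volume.restrict S) := ⟨by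
      rw [Measure.restrict_apply_univ]; exact hS.measure_lt_top⟩
    exact ((hF.restrict S).integrable (by norm_num)).norm.mul_const C
  refine Tendsto.sub (Tendsto.const_mul lam ?_) ?_
  · refine tendsto_integral_of_dominated_convergence (S.indicator fun x => ‖u x‖ * M) ?_ (hI hu M) ?_ ?_
    · intro n; exact hu.1.mul (hφ n).aestronglyMeasurable
    · intro n
      refine Eventually.of_forall fun x => ?_
      by_cases hx : x ∈ S
      · rw [indicator_of_mem hx, norm_mul]
        exact mul_le_mul_of_nonneg_left (hφM n x) (norm_nonneg _)
      · rw [indicator_of_notMem hx, image_eq_zero_of_notMem_tsupport fun h => hx (hφS n h)]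
        simp
    · exact Eventually.of_forall fun x => (hlim x).const_mul _
  · refine tendsto_integral_of_dominated_convergence (S.indicator fun x => ‖gradient u x‖ * K) ?_
      (hI hu2 K) ?_ ?_
    · intro n; exact hu2.1.inner (measurable_gradient _).aestronglyMeasurable
    · intro n
      refine Eventually.of_forall fun x => ?_
      by_cases hx : x ∈ S
      · rw [indicator_of_mem hx]
        exact (norm_inner_le_norm _ _).trans (mul_le_mul_of_nonneg_left (hφK n x) (norm_nonneg _))
      · rw [indicator_of_notMem hx, gradient_zero_off fun h => hx (hφS n h)]
        simp
    · filter_upwards [hglim] with x hx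
      exact Tendsto.inner tendsto_const_nhds hx

/-- If `Nf` is represented by a locally finite measure on test functions, then also on Lipschitz
functions. -/
lemma Nf_lip_eq (lam : ℝ) {u g : Euc d → ℝ} {U : Set (Euc d)} (hU : IsOpen U) {K : ℝ≥0}
    (hu : MemLp u 2 (volume : Measure (Euc d)))
    (hu2 : MemLp (fun x => gradient u x) 2 (volume : Measure (Euc d)))
    (ν : Measure (Euc d)) (hν : ∀ φ, TestFun U φ → ∫ x, φ x ∂ν = Nf lam u φ)
    (hfin : ∀ S, IsCompact S → S ⊆ U → ν S < ⊤)
    (hg : LipschitzWith K g) (hgc : HasCompactSupport g) (hgU : tsupport g ⊆ U) :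
    ∫ x, g x ∂ν = Nf lam u g := by
  obtain ⟨φ, S, M, hS, hSU, hφ, hφS, hgS, hφM, hgM, hlim, hφK, hglim⟩ := lip_approx hU hg hgc hgU
  have h1 := Nf_tendsto lam hu hu2 hS (fun n => (hφ n).1.continuous) hφS hφM hlim hφK hglim
  have h2 : Tendsto (fun n => ∫ x, φ n x ∂ν) atTop (𝓝 (∫ x, g x ∂ν)) := by
    refine tendsto_integral_of_dominated_convergence (S.indicator fun x => M) ?_ ?_ ?_ ?_
    · intro n; exact (hφ n).1.continuous.aestronglyMeasurable
    · rw [integrable_indicator_iff hS.measurableSet]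
      exact integrableOn_const (hfin S hS hSU).ne
    · intro n
      refine Eventually.of_forall fun x => ?_
      by_cases hx : x ∈ S
      · rw [indicator_of_mem hx]; exact hφM n x
      · rw [indicator_of_notMem hx, image_eq_zero_of_notMem_tsupport fun h => hx (hφS n h)]
        simp
    · exact Eventually.of_forall hlim
  refine tendsto_nhds_unique h2 (h1.congr fun n => ?_)
  rw [hν _ (hφ n)]

end part2

section part3

def psi (z : Euc d) : ℝ := max (1 - ‖z‖ ^ 2) 0

def Psi (y : Euc d) (s : ℝ) (x : Euc d) : ℝ := (max (s ^ 2 - ‖x - y‖ ^ 2) 0) ^ 2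

def Af (u : Euc d → ℝ) (y : Euc d) (s : ℝ) : ℝ := ∫ z, u (y + s • z) * psi z

lemma psi_nonneg (z : Euc d) : 0 ≤ psi z := le_max_right _ _

lemma psi_le_one (z : Euc d) : psi z ≤ 1 := max_le (by nlinarith [norm_nonneg z]) zero_le_one

lemma psi_cont : Continuous (psi : Euc d → ℝ) := by unfold psi; fun_prop

lemma psi_zero {z : Euc d} (hz : 1 ≤ ‖z‖) : psi z = 0 := max_eq_right (by nlinarith)

lemma psi_supp : HasCompactSupport (psi : Euc d → ℝ) := by
  refine HasCompactSupport.intro (isCompact_closedBall (0 : Euc d) 1) fun x hx => psi_zero ?_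
  simp only [mem_closedBall, dist_zero_right, not_le] at hx
  exact hx.le

lemma psi_int : Integrable (psi : Euc d → ℝ) := psi_cont.integrable_of_hasCompactSupport psi_supp

lemma psi_pos : 0 < ∫ z : Euc d, psi z := by
  refine (integral_pos_iff_support_of_nonneg psi_nonneg psi_int).2 ?_
  refine (measure_ball_pos volume (0 : Euc d) one_pos).trans_le (measure_mono fun z hz => ?_)
  simp only [mem_ball, dist_zero_right] at hz
  have : 0 < psi z := lt_max_of_lt_left (by nlinarith [norm_nonneg z])
  exact this.ne'

lemma int_scale (f : Euc d → ℝ) (y : Euc d) {s : ℝ} (hs : 0 < s) :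
    ∫ z, f (y + s • z) = (s ^ d)⁻¹ * ∫ x, f x := by
  have h := Measure.integral_comp_smul (volume : Measure (Euc d)) (fun x => f (y + x)) s
  rw [h, integral_add_left_eq_self (fun x => f x) y]
  simp [abs_of_pos hs]

lemma Psi_cont (y : Euc d) (s : ℝ) : Continuous (Psi y s) := by unfold Psi; fun_prop

lemma Psi_nonneg (y : Euc d) (s : ℝ) (x : Euc d) : 0 ≤ Psi y s x := sq_nonneg _

lemma Psi_zero {y x : Euc d} {s : ℝ} (hs : 0 < s) (hx : x ∉ ball y s) : Psi y s x = 0 := by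
  simp only [mem_ball, dist_eq_norm, not_lt] at hx
  unfold Psi
  rw [max_eq_right (by nlinarith)]; simp

lemma Psi_le {y x : Euc d} {s : ℝ} : Psi y s x ≤ s ^ 4 := by
  unfold Psi
  have : max (s ^ 2 - ‖x - y‖ ^ 2) 0 ≤ s ^ 2 := max_le (by nlinarith [sq_nonneg ‖x - y‖]) (sq_nonneg _)
  calc _ ≤ (s ^ 2) ^ 2 := by gcongr
    _ = s ^ 4 := by ring

lemma Psi_tsupp {y : Euc d} {s : ℝ} (hs : 0 < s) : tsupport (Psi y s) ⊆ closedBall y s := by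
  refine closure_minimal (fun x hx => ?_) isClosed_closedBall
  by_contra h
  exact hx (Psi_zero hs fun h' => h (ball_subset_closedBall h'))

lemma Psi_supp {y : Euc d} {s : ℝ} (hs : 0 < s) : HasCompactSupport (Psi y s) :=
  (isCompact_closedBall y s).of_isClosed_subset (isClosed_tsupport _) (Psi_tsupp hs)

lemma Psi_lip (y : Euc d) {s : ℝ} (hs : 0 < s) : ∃ K, LipschitzWith K (Psi y s) := by
  refine ⟨Real.toNNReal (4 * s ^ 3), LipschitzWith.of_dist_le_mul fun x x' => ?_⟩
  have e : ∀ x, Psi y s x = (s ^ 2 - (min ‖x - y‖ s) ^ 2) ^ 2 := by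
    intro x
    unfold Psi
    rcases le_total ‖x - y‖ s with h | h
    · rw [min_eq_left h, max_eq_left]; nlinarith [norm_nonneg (x - y)]
    · rw [min_eq_right h, max_eq_right]; · ring
      nlinarith
  rw [Real.coe_toNNReal _ (by positivity), Real.dist_eq, e, e]
  set p := min ‖x - y‖ s
  set q := min ‖x' - y‖ s
  have hp : 0 ≤ p := le_min (norm_nonneg _) hs.le
  have hq : 0 ≤ q := le_min (norm_nonneg _) hs.le
  have hp' : p ≤ s := min_le_right _ _
  have hq' : q ≤ s := min_le_right _ _
  have hpq : |p - q| ≤ dist x x' := by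
    have h1 : |p - q| ≤ |‖x - y‖ - ‖x' - y‖| := abs_inf_sub_inf_le_abs _ _ _
    have h2 := abs_norm_sub_norm_le (x - y) (x' - y)
    rw [sub_sub_sub_cancel_right, ← dist_eq_norm] at h2
    exact h1.trans h2
  have : (s ^ 2 - p ^ 2) ^ 2 - (s ^ 2 - q ^ 2) ^ 2 = (p - q) * (-(p + q) * (2 * s ^ 2 - p ^ 2 - q ^ 2)) := by
    ring
  rw [this, abs_mul, mul_comm]
  refine mul_le_mul ?_ hpq (abs_nonneg _) (by positivity)
  have h3 : 0 ≤ 2 * s ^ 2 - p ^ 2 - q ^ 2 := by nlinarith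
  rw [abs_mul, abs_neg, abs_of_nonneg (by positivity), abs_of_nonneg h3]
  calc (p + q) * (2 * s ^ 2 - p ^ 2 - q ^ 2) ≤ (2 * s) * (2 * s ^ 2) := by
        apply mul_le_mul <;> nlinarith [sq_nonneg p, sq_nonneg q]
    _ = 4 * s ^ 3 := by ring

lemma inner_grad (f : Euc d → ℝ) (x v : Euc d) : ⟪gradient f x, v⟫ = fderiv ℝ f x v := by
  unfold gradient
  rw [InnerProductSpace.toDual_symm_apply]

lemma Psi_grad (y : Euc d) {s : ℝ} (hs : 0 < s) (x : Euc d) :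
    gradient (Psi y s) x = (-4 * max (s ^ 2 - ‖x - y‖ ^ 2) 0) • (x - y) := by
  by_cases hx : ‖x - y‖ < s
  · have h0 : 0 < s ^ 2 - ‖x - y‖ ^ 2 := by nlinarith [norm_nonneg (x - y)]
    rw [max_eq_left h0.le]
    have e : Psi y s =ᶠ[𝓝 x] fun x => (s ^ 2 - ‖x - y‖ ^ 2) ^ 2 := by
      have hc : Continuous fun x : Euc d => s ^ 2 - ‖x - y‖ ^ 2 := by fun_prop
      filter_upwards [hc.continuousAt.eventually (lt_mem_nhds h0)] with z hz
      unfold Psi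
      rw [max_eq_left hz.le]
    rw [Filter.EventuallyEq.gradient_eq e]
    refine HasGradientAt.gradient ?_
    rw [hasGradientAt_iff_hasFDerivAt]
    have h1 : HasFDerivAt (fun x : Euc d => x - y) (ContinuousLinearMap.id ℝ (Euc d)) x :=
      (hasFDerivAt_id x).sub_const y
    have h2 := h1.norm_sq
    have h3 := (h2.const_sub (s ^ 2)).pow 2
    refine h3.congr_fderiv ?_
    ext v
    simp [InnerProductSpace.toDual_apply_apply, real_inner_smul_left]
    ring
  · push Not at hx
    rw [max_eq_right (by nlinarith)]
    simp only [mul_zero, zero_smul]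
    have hz : Psi y s x = 0 := Psi_zero hs (by simpa [dist_eq_norm] using hx)
    have hm : IsLocalMin (Psi y s) x := Eventually.of_forall fun z => by
      rw [hz]; exact Psi_nonneg _ _ _
    unfold gradient
    rw [hm.fderiv_eq_zero, map_zero]

lemma lip_ext {D : Set (Euc d)} {u : Euc d → ℝ} (hlip : LocLipOn D u) {y : Euc d} {ρ : ℝ}
    (hb : closedBall y ρ ⊆ D) : ∃ (K : ℝ≥0) (w : Euc d → ℝ), LipschitzWith K w ∧
      ∀ x ∈ closedBall y ρ, w x = u x := by
  obtain ⟨K, hK⟩ := lip_on_compact hlip (isCompact_closedBall y ρ) hb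
  obtain ⟨w, hw, he⟩ := hK.extend_real
  exact ⟨K, w, hw, fun x hx => (he hx).symm⟩

lemma mem_cb {y z : Euc d} {s ρ : ℝ} (hs : 0 ≤ s) (hsρ : s ≤ ρ) (hz : ‖z‖ < 1) :
    y + s • z ∈ closedBall y ρ := by
  simp only [mem_closedBall, dist_self_add_left, norm_smul, Real.norm_of_nonneg hs]
  nlinarith [norm_nonneg z]

lemma Af_congr {u w : Euc d → ℝ} {y : Euc d} {ρ : ℝ} (he : ∀ x ∈ closedBall y ρ, w x = u x)
    {s : ℝ} (hs : 0 ≤ s) (hsρ : s ≤ ρ) : Af u y s = Af w y s := by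
  unfold Af
  congr 1; ext z
  by_cases hz : ‖z‖ < 1
  · rw [he _ (mem_cb hs hsρ hz)]
  · rw [psi_zero (not_lt.1 hz)]; simp

lemma Af_int {w : Euc d → ℝ} (hw : Continuous w) (y : Euc d) (s : ℝ) :
    Integrable fun z => w (y + s • z) * psi z := by
  refine Continuous.integrable_of_hasCompactSupport (by have := psi_cont (d := d); fun_prop) ?_
  exact psi_supp.mul_left

lemma Af_F_lip {w : Euc d → ℝ} {K : ℝ≥0} (hw : LipschitzWith K w) (y : Euc d) (s s' : ℝ) (z : Euc d) :
    |w (y + s • z) * psi z - w (y + s' • z) * psi z| ≤ (K * psi z) * |s - s'| := by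
  by_cases hz : ‖z‖ < 1
  · rw [← sub_mul, abs_mul, abs_of_nonneg (psi_nonneg z)]
    have h1 := hw.dist_le_mul (y + s • z) (y + s' • z)
    rw [Real.dist_eq, dist_add_left, dist_eq_norm, ← sub_smul, norm_smul, Real.norm_eq_abs] at h1
    have h2 : |s - s'| * ‖z‖ ≤ |s - s'| * 1 := by gcongr
    have h3 : |w (y + s • z) - w (y + s' • z)| ≤ K * |s - s'| := h1.trans (by
      rw [mul_one] at h2; gcongr)
    nlinarith [psi_nonneg z]
  · rw [psi_zero (not_lt.1 hz)]; simp

lemma Af_lip {w : Euc d → ℝ} {K : ℝ≥0} (hw : LipschitzWith K w) (y : Euc d) (s s' : ℝ) :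
    |Af w y s - Af w y s'| ≤ (K * ∫ z : Euc d, psi z) * |s - s'| := by
  unfold Af
  rw [← integral_sub (Af_int hw.continuous y s) (Af_int hw.continuous y s')]
  refine (abs_integral_le_integral_abs).trans ?_
  have : (K * ∫ z : Euc d, psi z) * |s - s'| = ∫ z : Euc d, (K * psi z) * |s - s'| := by
    rw [integral_mul_const, integral_const_mul]
  rw [this]
  refine integral_mono_of_nonneg (Eventually.of_forall fun z => abs_nonneg _) ?_
    (Eventually.of_forall fun z => Af_F_lip hw y s s' z)
  exact (psi_int.const_mul _).mul_const _

lemma Af_zero (u : Euc d → ℝ) (y : Euc d) : Af u y 0 = u y * ∫ z : Euc d, psi z := by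
  unfold Af; simp [integral_const_mul]

lemma Af_contOn {D : Set (Euc d)} {u : Euc d → ℝ} (hlip : LocLipOn D u) {y : Euc d} {ρ : ℝ}
    (hb : closedBall y ρ ⊆ D) : ContinuousOn (Af u y) (Icc 0 ρ) := by
  obtain ⟨K, w, hw, he⟩ := lip_ext hlip hb
  have hc : Continuous (Af w y) := by
    have : LipschitzWith (K * (∫ z : Euc d, psi z).toNNReal) (Af w y) := by
      refine LipschitzWith.of_dist_le_mul fun s s' => ?_
      rw [NNReal.coe_mul, Real.coe_toNNReal _ psi_pos.le, Real.dist_eq, Real.dist_eq]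
      exact Af_lip hw y s s'
    exact this.continuous
  exact hc.continuousOn.congr fun s hs => Af_congr he hs.1 hs.2

lemma ae_scale {p : Euc d → Prop} (h : ∀ᵐ x : Euc d, p x) (y : Euc d) {s : ℝ} (hs : 0 < s) :
    ∀ᵐ z : Euc d, p (y + s • z) := by
  rw [ae_iff] at h ⊢
  have e : {z : Euc d | ¬ p (y + s • z)} = (fun z : Euc d => s • z) ⁻¹' ((fun x => y + x) ⁻¹' {x | ¬ p x}) := rfl
  rw [e, Measure.addHaar_preimage_smul _ hs.ne', measure_preimage_add, h, mul_zero]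

lemma Af_deriv (lam : ℝ) {D : Set (Euc d)} {u : Euc d → ℝ} (hlip : LocLipOn D u) {y : Euc d} {ρ : ℝ}
    (hb : closedBall y ρ ⊆ D) {s : ℝ} (hs : 0 < s) (hsρ : s < ρ) :
    HasDerivAt (Af u y) ((1 / 4) * (s ^ (d + 3))⁻¹ *
      (Nf lam u (Psi y s) - lam * ∫ x, u x * Psi y s x)) s := by
  obtain ⟨K, w, hw, he⟩ := lip_ext hlip hb
  have hev : Af u y =ᶠ[𝓝 s] Af w y := by
    filter_upwards [Ioo_mem_nhds hs hsρ] with t ht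
    exact Af_congr he ht.1.le ht.2.le
  have h1 : HasDerivAt (Af w y) (∫ z, ⟪gradient w (y + s • z), z⟫ * psi z) s := by
    refine (hasDerivAt_integral_of_dominated_loc_of_lip (bound := fun z => K * psi z)
      (F := fun t z => w (y + t • z) * psi z) (s := univ) (Filter.univ_mem) ?_ ?_ ?_ ?_ ?_ ?_).2
    · exact Eventually.of_forall fun t => (Af_int hw.continuous y t).1
    · exact Af_int hw.continuous y s
    · have : Measurable fun z : Euc d => gradient w (y + s • z) :=
        (measurable_gradient w).comp (by fun_prop)
      exact ((this.inner measurable_id).mul psi_cont.measurable).aestronglyMeasurable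
    · refine Eventually.of_forall fun z => LipschitzWith.lipschitzOnWith ?_
      refine LipschitzWith.of_dist_le_mul fun t t' => ?_
      rw [Real.dist_eq, Real.dist_eq]
      have := Af_F_lip hw y t t' z
      rwa [Real.coe_nnabs, abs_of_nonneg (mul_nonneg K.coe_nonneg (psi_nonneg z))]
    · exact psi_int.const_mul _
    · filter_upwards [ae_scale hw.ae_differentiableAt y hs] with z hz
      refine HasDerivAt.mul_const ?_ _
      have h2 : HasDerivAt (fun t : ℝ => y + t • z) z s := by
        simpa using ((hasDerivAt_id s).smul_const z).const_add y
      have := hz.hasFDerivAt.comp_hasDerivAt s h2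
      rw [inner_grad]
      exact this
  refine (h1.congr_of_eventuallyEq hev).congr_deriv ?_
  have e2 : ∀ z, ⟪gradient w (y + s • z), z⟫ * psi z =
      -(1 / 4) * (s ^ 3)⁻¹ * ⟪gradient u (y + s • z), gradient (Psi y s) (y + s • z)⟫ := by
    intro z
    rw [Psi_grad y hs, inner_smul_right]
    have e3 : max (s ^ 2 - ‖y + s • z - y‖ ^ 2) 0 = s ^ 2 * psi z := by
      unfold psi
      rw [add_sub_cancel_left, norm_smul, Real.norm_of_nonneg hs.le, mul_max_of_nonneg _ _ (sq_nonneg s)]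
      congr 1 <;> ring
    rw [e3, add_sub_cancel_left, inner_smul_right]
    by_cases hz : ‖z‖ < 1
    · have : gradient w (y + s • z) = gradient u (y + s • z) := by
        apply Filter.EventuallyEq.gradient_eq
        have : y + s • z ∈ ball y ρ := by
          simp only [mem_ball, dist_self_add_left, norm_smul, Real.norm_of_nonneg hs.le]
          nlinarith [norm_nonneg z]
        filter_upwards [isOpen_ball.mem_nhds this] with x hx
        exact he x (ball_subset_closedBall hx)
      rw [this]
      field_simp
    · rw [psi_zero (not_lt.1 hz)]; simp
  simp only [e2]
  rw [integral_const_mul, int_scale (fun x => ⟪gradient u x, gradient (Psi y s) x⟫) y hs]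
  unfold Nf
  rw [pow_add, mul_inv]
  ring

end part3

section part4

lemma Af_nonneg {u : Euc d → ℝ} (hnn : ∀ x, 0 ≤ u x) (y : Euc d) (s : ℝ) : 0 ≤ Af u y s :=
  integral_nonneg fun z => mul_nonneg (hnn _) (psi_nonneg z)

lemma uPsi_nonneg {u : Euc d → ℝ} (hnn : ∀ x, 0 ≤ u x) (y : Euc d) (s : ℝ) :
    0 ≤ ∫ x, u x * Psi y s x :=
  integral_nonneg fun z => mul_nonneg (hnn _) (Psi_nonneg _ _ _)

lemma max_principle {lam : ℝ} (hlam : 0 ≤ lam) {D : Set (Euc d)} {u : Euc d → ℝ}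
    (hnn : ∀ x, 0 ≤ u x) (hlip : LocLipOn D u)
    {y : Euc d} {ρ : ℝ} (hρ : 0 < ρ) (hb : closedBall y ρ ⊆ D) (h0 : u y = 0)
    (hN : ∀ s, 0 < s → s < ρ → Nf lam u (Psi y s) ≤ 0) : ∀ x ∈ ball y ρ, u x = 0 := by
  have hanti : AntitoneOn (Af u y) (Icc 0 ρ) := by
    refine antitoneOn_of_deriv_nonpos (convex_Icc 0 ρ) (Af_contOn hlip hb) ?_ ?_
    · intro s hs
      rw [interior_Icc] at hs
      exact (Af_deriv lam hlip hb hs.1 hs.2).differentiableAt.differentiableWithinAt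
    · intro s hs
      rw [interior_Icc] at hs
      rw [(Af_deriv lam hlip hb hs.1 hs.2).deriv]
      have := hN s hs.1 hs.2
      have := uPsi_nonneg hnn y s
      have h3 : 0 ≤ (1 / 4 : ℝ) * (s ^ (d + 3))⁻¹ := by have := hs.1; positivity
      refine mul_nonpos_of_nonneg_of_nonpos h3 ?_
      nlinarith
  have hA : Af u y ρ ≤ 0 := by
    have := hanti (left_mem_Icc.2 hρ.le) (right_mem_Icc.2 hρ.le) hρ.le
    rwa [Af_zero, h0, zero_mul] at this
  obtain ⟨K, w, hw, he⟩ := lip_ext hlip hb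
  rw [Af_congr he hρ.le le_rfl] at hA
  intro x hx
  by_contra hne
  have hx0 : 0 < u x := lt_of_le_of_ne (hnn x) (Ne.symm hne)
  refine absurd hA (not_le.2 ?_)
  have hz : ‖ρ⁻¹ • (x - y)‖ < 1 := by
    rw [norm_smul, norm_inv, Real.norm_of_nonneg hρ.le, inv_mul_lt_iff₀ hρ, mul_one, ← dist_eq_norm]
    exact hx
  refine Continuous.integral_pos_of_hasCompactSupport_nonneg_nonzero
    (x := ρ⁻¹ • (x - y)) ?_ ?_ ?_ ?_
  · have := psi_cont (d := d); have := hw.continuous; fun_prop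
  · exact psi_supp.mul_left
  · intro z
    by_cases hz : ‖z‖ < 1
    · show 0 ≤ w (y + ρ • z) * psi z
      rw [he _ (mem_cb hρ.le le_rfl hz)]
      exact mul_nonneg (hnn _) (psi_nonneg _)
    · simp [psi_zero (not_lt.1 hz)]
  · rw [smul_inv_smul₀ hρ.ne', add_sub_cancel, he x (ball_subset_closedBall hx)]
    have : 0 < psi (ρ⁻¹ • (x - y)) := lt_max_of_lt_left (by nlinarith [norm_nonneg (ρ⁻¹ • (x - y))])
    positivity

/-- Local context: `ν` represents `Δu + lam u` on Lipschitz functions. -/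
structure Ctx (D : Set (Euc d)) (lam : ℝ) (u : Euc d → ℝ) (ν : Measure (Euc d)) : Prop where
  hD : IsOpen D
  hm : MemH10 D u
  nn : ∀ x, 0 ≤ u x
  lip : LocLipOn D u
  lam0 : 0 ≤ lam
  fin : ∀ S, IsCompact S → S ⊆ D → ν S < ⊤
  rep : ∀ (g : Euc d → ℝ) (K : ℝ≥0), LipschitzWith K g → HasCompactSupport g → tsupport g ⊆ D →
    ∫ x, g x ∂ν = Nf lam u g

variable {D : Set (Euc d)} {lam : ℝ} {u : Euc d → ℝ} {ν : Measure (Euc d)}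

lemma Af_int' (hlip : LocLipOn D u) {y : Euc d} {s : ℝ} (hs : 0 ≤ s) (hb : closedBall y s ⊆ D) :
    Integrable fun z => u (y + s • z) * psi z := by
  obtain ⟨K, w, hw, he⟩ := lip_ext hlip hb
  convert Af_int hw.continuous y s using 2 with z
  by_cases hz : ‖z‖ < 1
  · rw [he _ (mem_cb hs le_rfl hz)]
  · rw [psi_zero (not_lt.1 hz)]; simp

lemma uPsi_le (hnn : ∀ x, 0 ≤ u x) (hlip : LocLipOn D u) {y : Euc d} {s : ℝ} (hs : 0 < s)
    (hb : closedBall y s ⊆ D) : ∫ x, u x * Psi y s x ≤ s ^ (d + 4) * Af u y s := by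
  have h := int_scale (fun x => u x * Psi y s x) y hs
  have h1 : ∫ x, u x * Psi y s x = s ^ d * ∫ z, u (y + s • z) * Psi y s (y + s • z) := by
    rw [h, mul_inv_cancel_left₀ (by positivity)]
  rw [h1, pow_add, mul_assoc]
  refine mul_le_mul_of_nonneg_left ?_ (by positivity)
  unfold Af
  rw [← integral_const_mul]
  refine integral_mono_of_nonneg (Eventually.of_forall fun z => mul_nonneg (hnn _) (Psi_nonneg _ _ _))
    ((Af_int' hlip hs.le hb).const_mul _) (Eventually.of_forall fun z => ?_)
  have e : Psi y s (y + s • z) = s ^ 4 * psi z ^ 2 := by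
    unfold Psi psi
    rw [add_sub_cancel_left, norm_smul, Real.norm_of_nonneg hs.le]
    have : s ^ 2 - (s * ‖z‖) ^ 2 = s ^ 2 * (1 - ‖z‖ ^ 2) := by ring
    rw [this]
    have := mul_max_of_nonneg (1 - ‖z‖ ^ 2) 0 (sq_nonneg s)
    rw [mul_zero] at this
    rw [← this]; ring
  simp only [e]
  have h2 : psi z ^ 2 ≤ psi z := by nlinarith [psi_nonneg z, psi_le_one z]
  calc u (y + s • z) * (s ^ 4 * psi z ^ 2) = s ^ 4 * (u (y + s • z) * psi z ^ 2) := by ring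
    _ ≤ _ := by
      refine mul_le_mul_of_nonneg_left ?_ (by positivity)
      exact mul_le_mul_of_nonneg_left h2 (hnn _)

namespace Ctx

lemma int_Psi (c : Ctx D lam u ν) {y : Euc d} {s : ℝ} (hs : 0 < s) (hb : closedBall y s ⊆ D) :
    Nf lam u (Psi y s) = ∫ x, Psi y s x ∂ν := by
  obtain ⟨K, hK⟩ := Psi_lip y hs
  exact (c.rep _ K hK (Psi_supp hs) ((Psi_tsupp hs).trans hb)).symm

lemma deriv_bounds (c : Ctx D lam u ν) {y : Euc d} {ρ : ℝ} (hb : closedBall y ρ ⊆ D) {s : ℝ}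
    (hs : 0 < s) (hsρ : s < ρ) : ∃ A', HasDerivAt (Af u y) A' s ∧
      A' ≤ (1 / 4) * s * (s ^ d)⁻¹ * (ν (ball y s)).toReal ∧ (s ≤ 1 → - lam * Af u y s ≤ A') := by
  have hbs : closedBall y s ⊆ D := (closedBall_subset_closedBall hsρ.le).trans hb
  refine ⟨_, Af_deriv lam c.lip hb hs hsρ, ?_, ?_⟩
  · rw [c.int_Psi hs hbs]
    have h1 := uPsi_nonneg c.nn y s
    have h2 : ∫ x, Psi y s x ∂ν ≤ s ^ 4 * (ν (ball y s)).toReal := by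
      have e : Psi y s = (ball y s).indicator (Psi y s) := by
        ext x
        by_cases hx : x ∈ ball y s
        · simp [hx]
        · simp [hx, Psi_zero hs hx]
      have hf : ν (ball y s) < ⊤ := (measure_mono ball_subset_closedBall).trans_lt
        (c.fin _ (isCompact_closedBall y s) hbs)
      have h3 : ∫ x, Psi y s x ∂ν ≤ ∫ x in ball y s, s ^ 4 ∂ν := by
        rw [e, integral_indicator measurableSet_ball]
        refine integral_mono_of_nonneg (Eventually.of_forall fun x => Psi_nonneg _ _ _)
          (integrableOn_const hf.ne) (Eventually.of_forall fun x => Psi_le)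
      refine h3.trans (le_of_eq ?_)
      rw [setIntegral_const, smul_eq_mul, mul_comm]
      rfl
    have h4 : (∫ x, Psi y s x ∂ν) - lam * ∫ x, u x * Psi y s x ≤ s ^ 4 * (ν (ball y s)).toReal := by
      nlinarith [mul_nonneg c.lam0 h1]
    calc _ ≤ 1 / 4 * (s ^ (d + 3))⁻¹ * (s ^ 4 * (ν (ball y s)).toReal) := by gcongr
      _ = _ := by rw [pow_add]; field_simp
  · intro hs1
    rw [c.int_Psi hs hbs]
    have h1 := uPsi_le c.nn c.lip hs hbs
    have h2 : 0 ≤ ∫ x, Psi y s x ∂ν := integral_nonneg fun x => Psi_nonneg _ _ _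
    have hA := Af_nonneg c.nn y s
    have h3 : - (lam * (s ^ (d + 4) * Af u y s)) ≤ (∫ x, Psi y s x ∂ν) - lam * ∫ x, u x * Psi y s x := by
      have := mul_le_mul_of_nonneg_left h1 c.lam0
      linarith
    calc - lam * Af u y s ≤ 1 / 4 * (s ^ (d + 3))⁻¹ * (- (lam * (s ^ (d + 4) * Af u y s))) := by
          have : 1 / 4 * (s ^ (d + 3))⁻¹ * (- (lam * (s ^ (d + 4) * Af u y s))) =
            - (1 / 4 * s * (lam * Af u y s)) := by
              rw [pow_add s d 4, pow_add s d 3]; field_simp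
          rw [this]
          have := mul_nonneg c.lam0 hA
          nlinarith
      _ ≤ _ := by gcongr

lemma submean (c : Ctx D lam u ν) {y : Euc d} {ρ : ℝ} (hρ : 0 < ρ) (hρ1 : ρ ≤ 1)
    (hb : closedBall y ρ ⊆ D) : u y * (∫ z : Euc d, psi z) ≤ Real.exp lam * Af u y ρ := by
  have hmono : MonotoneOn (fun s => Real.exp (lam * s) * Af u y s) (Icc 0 ρ) := by
    have hd : ∀ s ∈ Ioo 0 ρ, ∃ A', HasDerivAt (fun s => Real.exp (lam * s) * Af u y s) A' s ∧ 0 ≤ A' := by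
      intro s hs
      obtain ⟨A', hA, _, hA2⟩ := c.deriv_bounds hb hs.1 hs.2
      have h2 := hA2 (hs.2.le.trans hρ1)
      have he : HasDerivAt (fun s => Real.exp (lam * s)) (Real.exp (lam * s) * lam) s := by
        simpa using ((hasDerivAt_id s).const_mul lam).exp
      refine ⟨_, he.mul hA, ?_⟩
      have : Real.exp (lam * s) * lam * Af u y s + Real.exp (lam * s) * A' =
        Real.exp (lam * s) * (A' - - lam * Af u y s) := by ring
      rw [this]
      exact mul_nonneg (Real.exp_pos _).le (by linarith)
    refine monotoneOn_of_deriv_nonneg (convex_Icc 0 ρ)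
      (ContinuousOn.mul (by fun_prop) (Af_contOn c.lip hb)) ?_ ?_
    · intro s hs
      rw [interior_Icc] at hs
      obtain ⟨A', h, _⟩ := hd s hs
      exact h.differentiableAt.differentiableWithinAt
    · intro s hs
      rw [interior_Icc] at hs
      obtain ⟨A', h, h'⟩ := hd s hs
      rwa [h.deriv]
  have := hmono (left_mem_Icc.2 hρ.le) (right_mem_Icc.2 hρ.le) hρ.le
  simp only [mul_zero, Real.exp_zero, one_mul, Af_zero] at this
  refine this.trans (mul_le_mul_of_nonneg_right ?_ (Af_nonneg c.nn _ _))
  exact Real.exp_le_exp.2 (by nlinarith [c.lam0])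

lemma u_intOn (c : Ctx D lam u ν) {y : Euc d} {ρ : ℝ} (hb : closedBall y ρ ⊆ D) :
    IntegrableOn u (closedBall y ρ) :=
  ((locLip_contOn c.lip).mono hb).integrableOn_compact (isCompact_closedBall y ρ)

lemma Af_le (c : Ctx D lam u ν) {y : Euc d} {ρ : ℝ} (hρ : 0 < ρ)
    (hb : closedBall y ρ ⊆ D) : Af u y ρ ≤ (ρ ^ d)⁻¹ * ∫ x in closedBall y ρ, u x := by
  rw [← integral_indicator measurableSet_closedBall, ← int_scale _ y hρ]
  have hi : Integrable ((closedBall y ρ).indicator u) :=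
    (integrable_indicator_iff measurableSet_closedBall).2 (c.u_intOn hb)
  refine integral_mono_of_nonneg (Eventually.of_forall fun z => mul_nonneg (c.nn _) (psi_nonneg _)) ?_
    (Eventually.of_forall fun z => ?_)
  · exact (hi.comp_add_left y).comp_smul hρ.ne'
  · by_cases hz : ‖z‖ < 1
    · simp only [indicator_of_mem (mem_cb hρ.le le_rfl hz)]
      exact mul_le_of_le_one_right (c.nn _) (psi_le_one z)
    · simp only [psi_zero (not_lt.1 hz), mul_zero]
      exact indicator_nonneg (fun x _ => c.nn x) _

end Ctx

end part4

section part5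

section setup
variable {D : Set (Euc d)} {lam a : ℝ} {u : Euc d → ℝ} {ν : Measure (Euc d)}

lemma Om_open (hD : IsOpen D) (hlip : LocLipOn D u) : IsOpen (Om D u) := by
  have : Om D u = D ∩ u ⁻¹' {0}ᶜ := rfl
  rw [this]
  exact (locLip_contOn hlip).isOpen_inter_preimage hD isOpen_compl_singleton

lemma frontier_zero (hD : IsOpen D) (hlip : LocLipOn D u) {x : Euc d}
    (hx : x ∈ frontier (Om D u)) (hxD : x ∈ D) : u x = 0 := by
  by_contra h
  have h1 : x ∈ Om D u := ⟨hxD, h⟩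
  rw [(Om_open hD hlip).frontier_eq] at hx
  exact hx.2 h1

lemma frontier_ne {x : Euc d} (hx : x ∈ frontier (Om D u)) {ρ : ℝ} (hρ : 0 < ρ) :
    ∃ y ∈ ball x ρ, y ∈ D ∧ u y ≠ 0 := by
  have := frontier_subset_closure hx
  obtain ⟨y, hy, hy'⟩ := Metric.mem_closure_iff.1 this ρ hρ
  exact ⟨y, by rwa [mem_ball, dist_comm], hy.1, hy.2⟩

lemma noharm (hD : IsOpen D) (hm : MemH10 D u) (hnn : ∀ x, 0 ≤ u x) (hlip : LocLipOn D u)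
    (hlam : 0 ≤ lam) {x : Euc d} (hx : x ∈ frontier (Om D u)) (hxD : x ∈ D) {ρ : ℝ} (hρ : 0 < ρ)
    (hb : closedBall x ρ ⊆ D) (hN : ∀ φ, TestFun (ball x ρ) φ → Nf lam u φ = 0) : False := by
  have h1 : ∀ s, 0 < s → s < ρ → Nf lam u (Psi x s) ≤ 0 := by
    intro s hs hsρ
    obtain ⟨K, hK⟩ := Psi_lip x hs
    have := Nf_lip_eq lam isOpen_ball hm.1 hm.2.1 (0 : Measure (Euc d))
      (fun φ hφ => by rw [hN φ hφ]; simp) (fun S _ _ => by simp) hK (Psi_supp hs)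
      ((Psi_tsupp hs).trans (closedBall_subset_ball hsρ))
    rw [← this]; simp
  have h2 := max_principle hlam hnn hlip hρ hb (frontier_zero hD hlip hx hxD) h1
  obtain ⟨y, hy, _, hy'⟩ := frontier_ne hx hρ
  exact hy' (h2 y hy)

lemma exists_cb (hD : IsOpen D) {x : Euc d} (hx : x ∈ D) : ∃ ρ > 0, closedBall x ρ ⊆ D :=
  Metric.nhds_basis_closedBall.mem_iff.1 (hD.mem_nhds hx)

lemma TestFun.mono {U V : Set (Euc d)} {φ : Euc d → ℝ} (h : TestFun U φ) (hUV : U ⊆ V) : TestFun V φ :=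
  ⟨h.1, h.2.1, h.2.2.trans hUV⟩

lemma fin_lemma (hD : IsOpen D) (hm : MemH10 D u) (hnn : ∀ x, 0 ≤ u x) (hlip : LocLipOn D u)
    (hlam : 0 ≤ lam) (hν : ∀ φ, TestFun D φ → ∫ x, φ x ∂ν = Nf lam u φ)
    {xc : Euc d} (hx : xc ∈ frontier (Om D u)) (hxD : xc ∈ D) :
    ∀ S, IsCompact S → S ⊆ D → ν S < ⊤ := by
  intro S hS hSD
  refine hS.measure_lt_top_of_nhdsWithin fun x hxS => ?_
  obtain ⟨χ, hχ1, hχ2, hχ3, hχ4, hχ5⟩ :=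
    exists_contDiff_tsupport_subset (n := (⊤ : ℕ∞)) (hD.mem_nhds (hSD hxS))
  have hχ : TestFun D χ := ⟨hχ3, hχ2, hχ1⟩
  by_cases hi : Integrable χ ν
  · refine Measure.FiniteAtFilter.filter_mono nhdsWithin_le_nhds ⟨{z | (1 / 2 : ℝ) ≤ ‖χ z‖}, ?_, hi.measure_norm_ge_lt_top (by norm_num)⟩
    have hc : ContinuousAt (fun z => ‖χ z‖) x := hχ3.continuous.norm.continuousAt
    have : (1 / 2 : ℝ) < ‖χ x‖ := by rw [hχ5]; norm_num
    filter_upwards [hc.eventually (lt_mem_nhds this)] with z hz using hz.le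
  · exfalso
    obtain ⟨ρ, hρ, hb⟩ := exists_cb hD hxD
    refine noharm hD hm hnn hlip hlam hx hxD hρ hb fun φ hφ => ?_
    have hφD := hφ.mono (ball_subset_closedBall.trans hb)
    by_cases hφi : Integrable φ ν
    · obtain ⟨K, hK⟩ := testFun_lip hφD
      obtain ⟨K', hK'⟩ := testFun_lip hχ
      have h1 : ¬ Integrable (fun x => φ x + χ x) ν := by
        intro h
        apply hi
        have := h.sub hφi
        refine this.congr (Eventually.of_forall fun x => ?_)
        simp
      have h2 := hν (fun x => φ x + χ x) ⟨hφD.1.add hχ.1, hφD.2.1.add hχ.2.1,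
        (tsupport_add _ _).trans (union_subset hφD.2.2 hχ.2.2)⟩
      rw [integral_undef h1, Nf_add lam hm.1 hm.2.1 hK hφD.2.1 hK' hχ.2.1, ← hν χ hχ,
        integral_undef hi] at h2
      linarith
    · rw [← hν φ hφD, integral_undef hφi]

lemma gradient_smul' {g : Euc d → ℝ} {K : ℝ≥0} (hg : LipschitzWith K g) (t : ℝ) :
    ∀ᵐ x : Euc d, gradient (fun y => t * g y) x = t • gradient g x := by
  filter_upwards [hg.ae_differentiableAt] with x hx
  simp only [gradient]
  rw [fderiv_const_mul hx]; simp

lemma Nf_smul (lam : ℝ) (u : Euc d → ℝ) {g : Euc d → ℝ} {K : ℝ≥0} (hg : LipschitzWith K g) (t : ℝ) :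
    Nf lam u (fun x => t * g x) = t * Nf lam u g := by
  have h1 : (∫ x, u x * (t * g x)) = t * ∫ x, u x * g x := by
    rw [← integral_const_mul]; congr 1; ext x; ring
  have h2 : (∫ x, ⟪gradient u x, gradient (fun x => t * g x) x⟫) = t * ∫ x, ⟪gradient u x, gradient g x⟫ := by
    rw [← integral_const_mul]
    refine integral_congr_ae ?_
    filter_upwards [gradient_smul' hg t] with x hx
    rw [hx, inner_smul_right]
  unfold Nf; rw [h1, h2]; ring

lemma lip_smul {g : Euc d → ℝ} {K : ℝ≥0} (hg : LipschitzWith K g) (t : ℝ) :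
    LipschitzWith (‖t‖₊ * K) (fun x => t * g x) := by
  have := (lipschitzWith_smul (α := ℝ) (β := ℝ) t).comp hg
  exact this

lemma int_grad_smul {g : Euc d → ℝ} {K : ℝ≥0} (hg : LipschitzWith K g) (t : ℝ) :
    (∫ x, ‖gradient (fun y => t * g y) x‖ ^ 2) = t ^ 2 * ∫ x, ‖gradient g x‖ ^ 2 := by
  rw [← integral_const_mul]
  refine integral_congr_ae ?_
  filter_upwards [gradient_smul' hg t] with x hx
  rw [hx, norm_smul, mul_pow, Real.norm_eq_abs, sq_abs]

lemma tsupp_smul (g : Euc d → ℝ) (t : ℝ) : tsupport (fun x => t * g x) ⊆ tsupport g :=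
  closure_mono fun x hx => by
    simp only [Function.mem_support] at hx ⊢
    exact right_ne_zero_of_mul hx

lemma J_sub_smul (hm : MemH10 D u)
    (hlip : LocLipOn D u) {g : Euc d → ℝ}
    {K : ℝ≥0} (hg : LipschitzWith K g) (hgc : HasCompactSupport g) (hgD : tsupport g ⊆ D) (t : ℝ) :
    Jfun lam (fun x => u x - t * g x) =
      Jfun lam u + 2 * t * Nf lam u g + t ^ 2 * ((∫ x, ‖gradient g x‖ ^ 2) - lam * ∫ x, (g x) ^ 2) := by
  rw [J_sub lam hm hlip (lip_smul hg t) (hgc.mul_left) ((tsupp_smul g t).trans hgD), Nf_smul lam u hg,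
    int_grad_smul hg]
  have : (∫ x, (t * g x) ^ 2) = t ^ 2 * ∫ x, (g x) ^ 2 := by
    rw [← integral_const_mul]; congr 1; ext x; ring
  rw [this]; ring

lemma memH10_sub_smul (hD : IsOpen D) (hm : MemH10 D u)
    (hlip : LocLipOn D u) {g : Euc d → ℝ}
    {K : ℝ≥0} (hg : LipschitzWith K g) (hgc : HasCompactSupport g) (hgD : tsupport g ⊆ D) (t : ℝ) :
    MemH10 D (fun x => u x - t * g x) :=
  memH10_sub hD hm hlip (lip_smul hg t) (hgc.mul_left) ((tsupp_smul g t).trans hgD)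

lemma vol_lt (hDb : Bornology.IsBounded D) {s : Set (Euc d)} (hs : s ⊆ D) : volume s < ⊤ :=
  (hDb.subset hs).measure_lt_top

lemma mvol_Om_sub_le (hDb : Bornology.IsBounded D) {g : Euc d → ℝ} (hgD : tsupport g ⊆ D) (t : ℝ) :
    mvol (Om D (fun x => u x - t * g x)) ≤ mvol (Om D u) + mvol (tsupport g) := by
  have h1 : Om D (fun x => u x - t * g x) ⊆ Om D u ∪ tsupport g := by
    rintro x ⟨hx, hx'⟩
    by_cases h : x ∈ tsupport g
    · exact Or.inr h
    · left
      refine ⟨hx, ?_⟩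
      simpa [image_eq_zero_of_notMem_tsupport h] using hx'
  have f1 : volume (Om D u) ≠ ⊤ := (vol_lt hDb fun x hx => hx.1).ne
  have f2 : volume (tsupport g) ≠ ⊤ := (vol_lt hDb hgD).ne
  unfold mvol
  rw [← ENNReal.toReal_add f1 f2]
  exact ENNReal.toReal_mono (ENNReal.add_ne_top.2 ⟨f1, f2⟩) ((measure_mono h1).trans (measure_union_le _ _))

lemma mvol_Om_sub_ge (hDb : Bornology.IsBounded D) {g : Euc d → ℝ} (hgD : tsupport g ⊆ D) (t : ℝ) :
    mvol (Om D u) ≤ mvol (Om D (fun x => u x - t * g x)) + mvol (tsupport g) := by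
  have h1 : Om D u ⊆ Om D (fun x => u x - t * g x) ∪ tsupport g := by
    rintro x ⟨hx, hx'⟩
    by_cases h : x ∈ tsupport g
    · exact Or.inr h
    · left
      refine ⟨hx, ?_⟩
      simpa [image_eq_zero_of_notMem_tsupport h] using hx'
  have f1 : volume (Om D (fun x => u x - t * g x)) ≠ ⊤ := (vol_lt hDb fun x hx => hx.1).ne
  have f2 : volume (tsupport g) ≠ ⊤ := (vol_lt hDb hgD).ne
  unfold mvol
  rw [← ENNReal.toReal_add f1 f2]
  exact ENNReal.toReal_mono (ENNReal.add_ne_top.2 ⟨f1, f2⟩) ((measure_mono h1).trans (measure_union_le _ _))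

lemma mvol_cb (hd : 0 < d) (x : Euc d) {r : ℝ} (hr : 0 ≤ r) :
    mvol (closedBall x r) = r ^ d * mvol (ball (0 : Euc d) 1) := by
  unfold mvol
  rw [Measure.addHaar_closedBall volume x hr, ENNReal.toReal_mul, ENNReal.toReal_ofReal (by positivity)]
  simp

lemma mvol_nonneg (s : Set (Euc d)) : 0 ≤ mvol s := ENNReal.toReal_nonneg

lemma mvol_mono {s t : Set (Euc d)} (h : s ⊆ t) (ht : volume t < ⊤) : mvol s ≤ mvol t :=
  ENNReal.toReal_mono ht.ne (measure_mono h)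

lemma small_ball (hd : 0 < d) {ε : ℝ} (hε : 0 < ε) : ∃ r₁ > 0, ∀ (x : Euc d) (r : ℝ), 0 ≤ r → r ≤ r₁ →
    mvol (closedBall x r) ≤ ε := by
  refine ⟨min 1 (ε / (mvol (ball (0 : Euc d) 1) + 1)), ?_, fun x r hr hr1 => ?_⟩
  · have := mvol_nonneg (ball (0 : Euc d) 1); positivity
  · rw [mvol_cb hd x hr]
    have h0 := mvol_nonneg (ball (0 : Euc d) 1)
    have h1 : r ≤ 1 := hr1.trans (min_le_left _ _)
    have h2 := hr1.trans (min_le_right _ _)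
    rw [le_div_iff₀ (by positivity)] at h2
    have h3 : r ^ d ≤ r := pow_le_of_le_one hr h1 hd.ne'
    nlinarith

lemma vol_eq (hd : 0 < d) (hD : IsOpen D) (hDb : Bornology.IsBounded D) (hu : IsJMinimizer D a lam u)
    (hnn : ∀ x, 0 ≤ u x) (hlip : LocLipOn D u)
    (hlam : 0 ≤ lam) {xc : Euc d} (hx : xc ∈ frontier (Om D u)) (hxD : xc ∈ D) :
    mvol (Om D u) = a := by
  obtain ⟨hm, hle, hmin⟩ := hu
  by_contra hne
  have hlt : 0 < a - mvol (Om D u) := sub_pos.2 (lt_of_le_of_ne hle hne)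
  obtain ⟨ρ, hρ, hb⟩ := exists_cb hD hxD
  obtain ⟨r₁, hr₁, hsm⟩ := small_ball hd hlt
  have hb' : closedBall xc (min ρ r₁) ⊆ D := (closedBall_subset_closedBall (min_le_left _ _)).trans hb
  refine noharm hD hm hnn hlip hlam hx hxD (lt_min hρ hr₁) hb' fun φ hφ => ?_
  have hφD := hφ.mono (ball_subset_closedBall.trans hb')
  obtain ⟨K, hK⟩ := testFun_lip hφD
  set C := (∫ x, ‖gradient φ x‖ ^ 2) - lam * ∫ x, (φ x) ^ 2 with hC
  have key : ∀ t : ℝ, 0 ≤ 2 * t * Nf lam u φ + t ^ 2 * C := by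
    intro t
    have h1 := hmin _ (memH10_sub_smul hD hm hlip hK hφD.2.1 hφD.2.2 t) (by
      refine (mvol_Om_sub_le hDb hφD.2.2 t).trans ?_
      have h3 : mvol (tsupport φ) ≤ mvol (closedBall xc (min ρ r₁)) :=
        mvol_mono (hφ.2.2.trans ball_subset_closedBall) measure_closedBall_lt_top
      have h4 := hsm xc (min ρ r₁) (lt_min hρ hr₁).le (min_le_right _ _)
      linarith)
    rw [J_sub_smul hm hlip hK hφD.2.1 hφD.2.2 t] at h1
    linarith
  by_contra hN
  have h5 := key (- Nf lam u φ / (|C| + 1))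
  have hc : 0 < |C| + 1 := by positivity
  have h6 : 2 * (- Nf lam u φ / (|C| + 1)) * Nf lam u φ + (- Nf lam u φ / (|C| + 1)) ^ 2 * C =
    (Nf lam u φ ^ 2 / (|C| + 1) ^ 2) * (C - 2 * (|C| + 1)) := by field_simp; ring
  rw [h6] at h5
  have h7 : 0 < Nf lam u φ ^ 2 / (|C| + 1) ^ 2 := by positivity
  have h8 : C - 2 * (|C| + 1) < 0 := by have := le_abs_self C; have := abs_nonneg C; linarith
  nlinarith [mul_neg_of_pos_of_neg h7 h8]

end setup

/-- Full context with the perturbation inequalities. -/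
structure Ctx2 (D : Set (Euc d)) (lam : ℝ) (u : Euc d → ℝ) (ν : Measure (Euc d)) (B : Set (Euc d))
    (h μp μm : ℝ) : Prop extends Ctx D lam u ν where
  dpos : 0 < d
  bdd : Bornology.IsBounded D
  hB : IsOpen B
  hBD : B ⊆ D
  hpos : 0 < h
  μp0 : 0 ≤ μp
  μm0 : 0 < μm
  up : ∀ (g : Euc d → ℝ) (K : ℝ≥0), LipschitzWith K g → HasCompactSupport g → tsupport g ⊆ B →
    mvol (tsupport g) ≤ h → 2 * ∫ x, g x ∂ν ≤ (∫ x, ‖gradient g x‖ ^ 2) + μp * mvol (tsupport g)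
  dn : ∀ (g : Euc d → ℝ) (K : ℝ≥0), LipschitzWith K g → HasCompactSupport g → tsupport g ⊆ B →
    mvol (tsupport g) ≤ h → mvol (Om D (fun x => u x - g x)) ≤ mvol (Om D u) →
    Jfun lam u + μm * mvol (Om D u) ≤ Jfun lam (fun x => u x - g x) + μm * mvol (Om D (fun x => u x - g x))

lemma mk_ctx2 (hd : 0 < d) {D : Set (Euc d)} {a lama R : ℝ} {xc : Euc d} {u : Euc d → ℝ}
    {ν : Measure (Euc d)}
    (hD : IsOpen D) (hDb : Bornology.IsBounded D)
    (hlam : 0 ≤ lama) (hu : IsJMinimizer D a lama u)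
    (hnn : ∀ x, 0 ≤ u x) (hlip : LocLipOn D u)
    (hν : ∀ φ : Euc d → ℝ, TestFun D φ →
      (∫ x, φ x ∂ν) = lama * (∫ x, u x * φ x) - ∫ x, ⟪gradient u x, gradient φ x⟫)
    (hball : ball xc R ⊆ D) (hxc : xc ∈ frontier (Om D u) ∩ D)
    {h μp μm : ℝ} (hh : 0 < h) (hμp : μp ∈ Mplus D a lama u (ball xc R) h)
    (hμm : μm ∈ Mminus D a lama u (ball xc R) h) (hμm0 : 0 < μm) :
    Ctx2 D lama u ν (ball xc R) h μp μm := by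
  have hm := hu.1
  have hfin := fin_lemma hD hm hnn hlip hlam hν hxc.1 hxc.2
  have hrep : ∀ (g : Euc d → ℝ) (K : ℝ≥0), LipschitzWith K g → HasCompactSupport g → tsupport g ⊆ D →
    ∫ x, g x ∂ν = Nf lama u g := fun g K hg hgc hgD =>
      Nf_lip_eq lama hD hm.1 hm.2.1 ν hν hfin hg hgc hgD
  have hvol := vol_eq hd hD hDb hu hnn hlip hlam hxc.1 hxc.2
  have hF : ∀ (g : Euc d → ℝ) (K : ℝ≥0), LipschitzWith K g → HasCompactSupport g →
      tsupport g ⊆ ball xc R → ∀ t : ℝ, Fcal D (ball xc R) u (fun x => u x - t * g x) := by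
    intro g K hg hgc hgB t
    refine ⟨memH10_sub_smul hD hm hlip hg hgc (hgB.trans hball) t, ?_⟩
    simp only [sub_sub_cancel]
    exact memH10_lip isOpen_ball (lip_smul hg t) hgc.mul_left ((tsupp_smul g t).trans hgB)
  refine ⟨⟨hD, hm, hnn, hlip, hlam, hfin, hrep⟩, hd, hDb, isOpen_ball, hball, hh, hμp.1, hμm0, ?_, ?_⟩
  · intro g K hg hgc hgB hgv
    have hgD := hgB.trans hball
    have h1 := J_sub_smul (lam := lama) hm hlip hg hgc hgD (-1)
    have h2 := mvol_Om_sub_le (u := u) hDb hgD (-1)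
    have h3 : 0 ≤ lama * ∫ x, (g x) ^ 2 := mul_nonneg hlam (integral_nonneg fun x => sq_nonneg _)
    rw [hrep g K hg hgc hgD]
    have hmv := mvol_nonneg (tsupport g)
    rcases le_total a (mvol (Om D (fun x => u x - (-1) * g x))) with h4 | h4
    · have h5 := hμp.2 _ (hF g K hg hgc hgB (-1)) h4 (by linarith)
      have h6 := mul_le_mul_of_nonneg_left h2 hμp.1
      linarith
    · have h5 := hu.2.2 _ (hF g K hg hgc hgB (-1)).1 h4
      have := mul_nonneg hμp.1 hmv
      linarith
  · intro g K hg hgc hgB hgv hle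
    have hgD := hgB.trans hball
    have h2 := mvol_Om_sub_ge (u := u) hDb hgD 1
    have h3 := hF g K hg hgc hgB 1
    simp only [one_mul] at h2 h3
    exact hμm.2 _ h3 (by linarith) (by linarith)

end part5

section part6

section upper
variable {D B : Set (Euc d)} {lam h μp μm : ℝ} {u : Euc d → ℝ} {ν : Measure (Euc d)}

lemma Ctx.integrable (c : Ctx D lam u ν) {g : Euc d → ℝ} (hg : Continuous g) (hgc : HasCompactSupport g)
    (hgD : tsupport g ⊆ D) : Integrable g ν := by
  obtain ⟨M, hM⟩ := hg.bounded_above_of_compact_support hgc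
  refine Integrable.mono' (g := (tsupport g).indicator fun _ => M) ?_ hg.aestronglyMeasurable ?_
  · rw [integrable_indicator_iff hgc.isCompact.measurableSet]
    exact integrableOn_const (c.fin _ hgc.isCompact hgD).ne
  · refine Eventually.of_forall fun x => ?_
    by_cases hx : x ∈ tsupport g
    · rw [indicator_of_mem hx]; exact hM x
    · rw [indicator_of_notMem hx, image_eq_zero_of_notMem_tsupport hx]; simp

lemma Ctx2.up_thick (c : Ctx2 D lam u ν B h μp μm) {E S : Set (Euc d)} {t : ℝ} (ht : 0 < t)
    (hS : IsCompact S) (hSB : S ⊆ B) (hES : ∀ x, infDist x E < t → x ∈ S) (hv : mvol S ≤ h) :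
    2 * t * (ν E).toReal ≤ (1 + μp) * mvol S := by
  have hmv := mvol_nonneg S
  have hμp := c.μp0
  rcases E.eq_empty_or_nonempty with rfl | hE
  · simp; positivity
  set g : Euc d → ℝ := fun x => max (t - infDist x E) 0 with hg
  have hgl : LipschitzWith 1 g := by
    refine LipschitzWith.of_dist_le_mul fun x y => ?_
    have h1 := (lipschitz_infDist_pt E).dist_le_mul x y
    rw [Real.dist_eq] at h1 ⊢
    refine le_trans ?_ h1
    have h2 := abs_max_sub_max_le_abs (t - infDist x E) (t - infDist y E) 0
    rw [abs_sub_comm (infDist x E)]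
    have e3 : t - infDist x E - (t - infDist y E) = infDist y E - infDist x E := by ring
    rw [e3] at h2
    exact h2
  have hgS : tsupport g ⊆ S := by
    refine closure_minimal (fun x hx => hES x ?_) hS.isClosed
    by_contra hc
    exact hx (max_eq_right (by linarith))
  have hgc : HasCompactSupport g := hS.of_isClosed_subset (isClosed_tsupport _) hgS
  have hvol : mvol (tsupport g) ≤ mvol S := mvol_mono hgS hS.measure_lt_top
  have h1 := c.up g 1 hgl hgc (hgS.trans hSB) (hvol.trans hv)
  have h2 : (∫ x, ‖gradient g x‖ ^ 2) ≤ mvol S := by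
    calc (∫ x, ‖gradient g x‖ ^ 2) ≤ ∫ x, S.indicator (fun _ => (1 : ℝ)) x := by
          refine integral_mono_of_nonneg (Eventually.of_forall fun x => by positivity) ?_
            (Eventually.of_forall fun x => ?_)
          · rw [integrable_indicator_iff hS.measurableSet]
            exact integrableOn_const hS.measure_lt_top.ne
          · by_cases hx : x ∈ S
            · have := norm_gradient_le hgl x
              simp only [indicator_of_mem hx]
              simp only [NNReal.coe_one] at this
              nlinarith [norm_nonneg (gradient g x)]
            · simp [indicator_of_notMem hx, gradient_zero_off fun h => hx (hgS h)]
      _ = mvol S := by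
          rw [integral_indicator hS.measurableSet, setIntegral_const]; simp [mvol, Measure.real]
  have hi := c.toCtx.integrable hgl.continuous hgc (hgS.trans (hSB.trans c.hBD))
  have h3 := mul_meas_ge_le_integral_of_nonneg (Eventually.of_forall fun x => le_max_right _ _) hi t
  have h4 : (ν E).toReal ≤ ν.real {x | t ≤ g x} := by
    refine ENNReal.toReal_mono ?_ (measure_mono fun x hx => ?_)
    · refine ((measure_mono fun x hx => ?_).trans_lt (c.fin S hS (hSB.trans c.hBD))).ne
      refine hgS (subset_tsupport _ ?_)
      have : t ≤ g x := hx
      exact (ht.trans_le this).ne'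
    · have : infDist x E = 0 := infDist_zero_of_mem hx
      simp [hg, this]
  have h5 : t * (ν E).toReal ≤ ∫ x, g x ∂ν := (mul_le_mul_of_nonneg_left h4 ht.le).trans h3
  nlinarith [mul_le_mul_of_nonneg_left hvol hμp]

/-- interior ball bound -/
lemma Ctx2.up_ball (c : Ctx2 D lam u ν B h μp μm) : ∃ C > 0, ∃ r₁ > 0, ∀ (y : Euc d) (s : ℝ),
    0 < s → s ≤ r₁ → closedBall y (2 * s) ⊆ B → (ν (ball y s)).toReal ≤ C * s ^ (d - 1) := by
  obtain ⟨r₁, hr₁, hsm⟩ := small_ball c.dpos c.hpos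
  have hμp := c.μp0
  have hm1 := mvol_nonneg (ball (0 : Euc d) 1)
  refine ⟨(1 + μp) * (2 ^ d * mvol (ball (0 : Euc d) 1)) + 1, by positivity, r₁ / 2, by positivity, ?_⟩
  intro y s hs hs1 hb
  have h1 := c.up_thick (E := ball y s) hs (isCompact_closedBall y (2 * s)) hb (fun x hx => by
    obtain ⟨z, hz, hxz⟩ := (infDist_lt_iff ⟨y, mem_ball_self hs⟩).1 hx
    have := dist_triangle x z y
    rw [mem_ball] at hz
    rw [mem_closedBall]; linarith) (hsm y (2 * s) (by positivity) (by linarith))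
  rw [mvol_cb c.dpos y (by positivity), mul_pow] at h1
  have e : s ^ d = s * s ^ (d - 1) := by
    rw [← pow_succ', Nat.sub_add_cancel c.dpos]
  rw [e] at h1
  have hp : 0 < s ^ (d - 1) := by positivity
  have h2 : s * (2 * (ν (ball y s)).toReal) ≤ s * ((1 + μp) * (2 ^ d * mvol (ball (0 : Euc d) 1)) * s ^ (d - 1)) := by
    nlinarith
  have h3 := le_of_mul_le_mul_left h2 hs
  have h4 : 0 ≤ (ν (ball y s)).toReal := ENNReal.toReal_nonneg
  nlinarith
end upper

end part6

section part7

section nondeg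
variable {D B : Set (Euc d)} {lam h μp μm : ℝ} {u : Euc d → ℝ} {ν : Measure (Euc d)}

lemma Ctx2.dn_vol (c : Ctx2 D lam u ν B h μp μm) {y : Euc d} {ρ ε : ℝ} (hρ : 0 < ρ) (hε : 0 < ε)
    (hb : closedBall y ρ ⊆ B) (hv : mvol (closedBall y ρ) ≤ h) (hlam : lam * ρ ^ 2 ≤ 1)
    (hu : ∀ x ∈ closedBall y ρ, u x ≤ ε * ρ) :
    μm * mvol (Om D u ∩ ball y (ρ / 2)) ≤ 17 * ε ^ 2 * mvol (closedBall y ρ) := by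
  have hbD := hb.trans c.hBD
  obtain ⟨K, w, hw, he⟩ := lip_ext c.lip hbD
  set W : Euc d → ℝ := fun x => 4 * ε * max (dist x y - ρ / 2) 0 with hW
  have hWl : LipschitzWith (4 * ε).toNNReal W := by
    refine LipschitzWith.of_dist_le_mul fun x x' => ?_
    rw [Real.coe_toNNReal _ (by positivity), Real.dist_eq, hW]
    simp only
    rw [← mul_sub, abs_mul, abs_of_pos (by positivity : 0 < 4 * ε)]
    gcongr
    have h1 := abs_max_sub_max_le_abs (dist x y - ρ / 2) (dist x' y - ρ / 2) 0
    rw [sub_sub_sub_cancel_right] at h1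
    exact h1.trans (abs_dist_sub_le _ _ _)
  have hW0 : ∀ x, 0 ≤ W x := fun x => by positivity
  set f : Euc d → ℝ := fun x => max (min (w x) (ε * ρ) - W x) 0 with hf
  have hfl : LipschitzWith (K + (4 * ε).toNNReal) f := by
    have h1 := ((hw.min_const (ε * ρ)).sub hWl).max_const 0
    exact h1
  have hfS : tsupport f ⊆ closedBall y (3 * ρ / 4) := by
    refine closure_minimal (fun x hx => ?_) isClosed_closedBall
    by_contra hc
    rw [mem_closedBall, not_le] at hc
    refine hx (max_eq_right ?_)
    have h1 : dist x y - ρ / 2 ≤ max (dist x y - ρ / 2) 0 := le_max_left _ _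
    have h2 : ε * ρ ≤ W x := by simp only [hW]; nlinarith
    linarith [min_le_right (w x) (ε * ρ)]
  have hSS : closedBall y (3 * ρ / 4) ⊆ ball y ρ := closedBall_subset_ball (by linarith)
  have hSS' : tsupport f ⊆ closedBall y ρ := (hfS.trans hSS).trans ball_subset_closedBall
  have hfc : HasCompactSupport f :=
    (isCompact_closedBall y ρ).of_isClosed_subset (isClosed_tsupport _) hSS'
  have hfB : tsupport f ⊆ B := hSS'.trans hb
  have hf_in : ∀ x ∈ closedBall y ρ, f x = max (u x - W x) 0 := by
    intro x hx
    simp only [hf]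
    rw [he x hx, min_eq_left (hu x hx)]
  have hf0 : ∀ x, 0 ≤ f x := fun x => le_max_right _ _
  have hfu : ∀ x, f x ≤ u x := by
    intro x
    by_cases hx : x ∈ closedBall y ρ
    · rw [hf_in x hx]
      exact max_le (by linarith [hW0 x]) (c.nn x)
    · rw [image_eq_zero_of_notMem_tsupport fun h => hx (hSS' h)]; exact c.nn x
  have hOm : Om D (fun x => u x - f x) ⊆ Om D u \ ball y (ρ / 2) := by
    rintro x ⟨hx, hx'⟩
    simp only at hx'
    refine ⟨⟨hx, fun h0 => hx' ?_⟩, fun hxb => hx' ?_⟩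
    · have := hfu x; have := hf0 x
      linarith
    · have h1 : x ∈ closedBall y ρ := by
        rw [mem_ball] at hxb; rw [mem_closedBall]; linarith
      have h2 : W x = 0 := by
        simp only [hW]
        rw [mem_ball] at hxb
        rw [max_eq_right (by linarith)]; simp
      rw [hf_in x h1, h2, sub_zero, max_eq_left (c.nn x), sub_self]
  have hfin : volume (Om D u) < ⊤ := vol_lt c.bdd fun x hx => hx.1
  have hOm2 : mvol (Om D (fun x => u x - f x)) + mvol (Om D u ∩ ball y (ρ / 2)) ≤ mvol (Om D u) := by
    unfold mvol
    rw [← ENNReal.toReal_add]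
    · refine ENNReal.toReal_mono hfin.ne ?_
      calc _ ≤ volume (Om D u \ ball y (ρ / 2)) + volume (Om D u ∩ ball y (ρ / 2)) := by gcongr
        _ = volume (Om D u) := by rw [add_comm, measure_inter_add_diff _ measurableSet_ball]
    · exact (vol_lt c.bdd fun x hx => hx.1).ne
    · exact (vol_lt c.bdd fun x hx => hx.1.1).ne
  have hmn := mvol_nonneg (Om D u ∩ ball y (ρ / 2))
  have h1 := c.dn f _ hfl hfc hfB ((mvol_mono hSS' measure_closedBall_lt_top).trans hv) (by linarith)
  have hmv : MemH10 D (fun x => u x - f x) := memH10_sub c.hD c.hm c.lip hfl hfc (hfB.trans c.hBD)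
  have hI : ∀ C : ℝ, Integrable ((closedBall y ρ).indicator fun _ => C) := fun C => by
    rw [integrable_indicator_iff measurableSet_closedBall]
    exact integrableOn_const measure_closedBall_lt_top.ne
  have hI2 : ∀ C : ℝ, ∫ x, (closedBall y ρ).indicator (fun _ => C) x = C * mvol (closedBall y ρ) := fun C => by
    rw [integral_indicator measurableSet_closedBall, setIntegral_const, smul_eq_mul, mul_comm]; rfl
  have hgrad : (∫ x, ‖gradient (fun x => u x - f x) x‖ ^ 2) ≤
      (∫ x, ‖gradient u x‖ ^ 2) + 16 * ε ^ 2 * mvol (closedBall y ρ) := by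
    rw [← hI2, ← integral_add (c.hm.2.1.integrable_norm_pow (p := 2) (by norm_num)) (hI _)]
    refine integral_mono_of_nonneg (Eventually.of_forall fun x => by positivity)
      ((c.hm.2.1.integrable_norm_pow (p := 2) (by norm_num)).add (hI _)) ?_
    filter_upwards [ae_grad_sub c.lip hfl (hfB.trans c.hBD)] with x hx
    rcases (hf0 x).eq_or_lt with h0 | h0
    · have hmin : IsLocalMin f x := Eventually.of_forall fun z => by rw [← h0]; exact hf0 z
      have hg0 : gradient f x = 0 := by unfold gradient; rw [hmin.fderiv_eq_zero, map_zero]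
      rw [hx, hg0, sub_zero]
      have : 0 ≤ (closedBall y ρ).indicator (fun _ => 16 * ε ^ 2) x :=
        indicator_nonneg (fun _ _ => by positivity) _
      linarith
    · have hxb : x ∈ ball y ρ := hSS (hfS (subset_tsupport _ h0.ne'))
      have hev : (fun x => u x - f x) =ᶠ[𝓝 x] W := by
        filter_upwards [isOpen_ball.mem_nhds hxb,
          hfl.continuous.continuousAt.eventually (lt_mem_nhds h0)] with z hz hz'
        rw [hf_in z (ball_subset_closedBall hz)] at hz' ⊢
        rcases lt_max_iff.1 hz' with h | h
        · rw [max_eq_left h.le]; ring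
        · exact absurd h (lt_irrefl _)
      rw [Filter.EventuallyEq.gradient_eq hev, indicator_of_mem (ball_subset_closedBall hxb)]
      have h2 := norm_gradient_le hWl x
      rw [Real.coe_toNNReal _ (by positivity)] at h2
      nlinarith [norm_nonneg (gradient W x), sq_nonneg ‖gradient u x‖]
  have hsq : (∫ x, (u x) ^ 2) - (∫ x, (u x - f x) ^ 2) ≤ (ε * ρ) ^ 2 * mvol (closedBall y ρ) := by
    rw [← hI2, ← integral_sub c.hm.1.integrable_sq hmv.1.integrable_sq]
    refine integral_mono (c.hm.1.integrable_sq.sub hmv.1.integrable_sq) (hI _) fun x => ?_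
    by_cases hx : x ∈ closedBall y ρ
    · simp only [indicator_of_mem hx]
      have := hu x hx
      have := c.nn x
      nlinarith [sq_nonneg (u x - f x)]
    · simp only [indicator_of_notMem hx]
      rw [image_eq_zero_of_notMem_tsupport fun h => hx (hSS' h)]; simp
  unfold Jfun at h1
  have hM := mvol_nonneg (closedBall y ρ)
  have h3 := mul_le_mul_of_nonneg_left hsq c.lam0
  have h4 : lam * ((ε * ρ) ^ 2 * mvol (closedBall y ρ)) ≤ ε ^ 2 * mvol (closedBall y ρ) := by
    have : lam * ((ε * ρ) ^ 2 * mvol (closedBall y ρ)) = (lam * ρ ^ 2) * (ε ^ 2 * mvol (closedBall y ρ)) := by ring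
    rw [this]
    exact mul_le_of_le_one_left (by positivity) hlam
  have h5 := mul_le_mul_of_nonneg_left hOm2 c.μm0.le
  linarith

lemma Ctx2.decay (c : Ctx2 D lam u ν B h μp μm) : ∃ ε > 0, ∃ ρ₀ > 0, ρ₀ ≤ 1 ∧ ∀ (y : Euc d) (ρ : ℝ),
    0 < ρ → ρ ≤ ρ₀ → closedBall y ρ ⊆ B → (∀ x ∈ closedBall y ρ, u x ≤ ε * ρ) →
    ∀ z ∈ closedBall y (ρ / 4), u z ≤ ε * (ρ / 4) := by
  obtain ⟨r₁, hr₁, hsm⟩ := small_ball c.dpos c.hpos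
  set κ := ∫ z : Euc d, psi z with hκ
  have hκ0 : 0 < κ := psi_pos
  set ω := mvol (ball (0 : Euc d) 1) with hω
  have hω0 : 0 ≤ ω := mvol_nonneg _
  have hμ := c.μm0
  have hlam := c.lam0
  set Q := Real.exp lam * 8 ^ d * (17 * ω) * 4 + 1 with hQ
  have hQ0 : 0 < Q := by positivity
  refine ⟨min 1 (κ * μm / Q), by positivity, min (min 1 r₁) (1 / (lam + 1)), by positivity,
    (min_le_left _ _).trans (min_le_left _ _), ?_⟩
  set ε := min 1 (κ * μm / Q) with hε
  have hε0 : 0 < ε := by positivity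
  have hε1 : ε ≤ 1 := min_le_left _ _
  have hε2 : ε * Q ≤ κ * μm := by
    have : ε ≤ κ * μm / Q := min_le_right _ _
    rwa [le_div_iff₀ hQ0] at this
  intro y ρ hρ hρ1 hb hu z hz
  have hr1 : ρ ≤ 1 := hρ1.trans ((min_le_left _ _).trans (min_le_left _ _))
  have hr2 : ρ ≤ r₁ := hρ1.trans ((min_le_left _ _).trans (min_le_right _ _))
  have hr3 : ρ * (lam + 1) ≤ 1 := by
    have : ρ ≤ 1 / (lam + 1) := hρ1.trans (min_le_right _ _)
    rwa [le_div_iff₀ (by positivity)] at this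
  have h1 := c.dn_vol hρ hε0 hb (hsm y ρ hρ.le hr2) (by nlinarith) hu
  rw [mvol_cb c.dpos y hρ.le, ← hω] at h1
  set m := mvol (Om D u ∩ ball y (ρ / 2)) with hm
  have hsub : closedBall z (ρ / 8) ⊆ ball y (ρ / 2) := by
    intro x hx
    rw [mem_closedBall] at hx hz
    rw [mem_ball]
    linarith [dist_triangle x z y]
  have hsub2 : closedBall z (ρ / 8) ⊆ closedBall y ρ := fun x hx => by
    have := hsub hx
    rw [mem_ball] at this; rw [mem_closedBall]; linarith
  have hzD : closedBall z (ρ / 8) ⊆ D := (hsub2.trans hb).trans c.hBD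
  have h2 := c.toCtx.submean (by positivity : 0 < ρ / 8) (by linarith) hzD
  have h3 := c.toCtx.Af_le (by positivity : 0 < ρ / 8) hzD
  have h4 : ∫ x in closedBall z (ρ / 8), u x ≤ ε * ρ * m := by
    have hme : MeasurableSet (Om D u ∩ ball y (ρ / 2)) :=
      ((Om_open c.hD c.lip).inter isOpen_ball).measurableSet
    have hfi : volume (Om D u ∩ ball y (ρ / 2)) < ⊤ := (measure_mono inter_subset_right).trans_lt measure_ball_lt_top
    have e1 : ε * ρ * m = ∫ x, (Om D u ∩ ball y (ρ / 2)).indicator (fun _ => ε * ρ) x := by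
      rw [integral_indicator hme, setIntegral_const, smul_eq_mul, mul_comm]; rfl
    rw [e1, ← integral_indicator measurableSet_closedBall]
    refine integral_mono_of_nonneg (Eventually.of_forall fun x => indicator_nonneg (fun x _ => c.nn x) _) ?_
      (Eventually.of_forall fun x => ?_)
    · rw [integrable_indicator_iff hme]
      exact integrableOn_const hfi.ne
    · by_cases hx : x ∈ closedBall z (ρ / 8)
      · simp only [indicator_of_mem hx]
        by_cases hx0 : u x = 0
        · rw [hx0]; exact indicator_nonneg (fun _ _ => by positivity) _
        · rw [indicator_of_mem (show x ∈ Om D u ∩ ball y (ρ / 2) from ⟨⟨hzD hx, hx0⟩, hsub hx⟩)]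
          exact hu x (hsub2 hx)
      · simp only [indicator_of_notMem hx]
        exact indicator_nonneg (fun _ _ => by positivity) _
  have h5 : u z * κ ≤ Real.exp lam * (((ρ / 8) ^ d)⁻¹ * (ε * ρ * m)) := by
    refine h2.trans ?_
    gcongr
    exact h3.trans (by gcongr)
  have h6 : ((ρ / 8) ^ d)⁻¹ * ρ ^ d = 8 ^ d := by
    rw [div_pow]; field_simp
  have h7 : u z * κ * μm ≤ Real.exp lam * 8 ^ d * (17 * ω) * ε ^ 3 * ρ := by
    calc u z * κ * μm ≤ Real.exp lam * (((ρ / 8) ^ d)⁻¹ * (ε * ρ * m)) * μm := by gcongr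
      _ = Real.exp lam * ((ρ / 8) ^ d)⁻¹ * ε * ρ * (μm * m) := by ring
      _ ≤ Real.exp lam * ((ρ / 8) ^ d)⁻¹ * ε * ρ * (17 * ε ^ 2 * (ρ ^ d * ω)) := by gcongr
      _ = Real.exp lam * (((ρ / 8) ^ d)⁻¹ * ρ ^ d) * (17 * ω) * ε ^ 3 * ρ := by ring
      _ = _ := by rw [h6]
  have h8 : Real.exp lam * 8 ^ d * (17 * ω) * ε ^ 3 * ρ * 4 ≤ (κ * μm) * (ε * ρ) := by
    calc Real.exp lam * 8 ^ d * (17 * ω) * ε ^ 3 * ρ * 4 = (Q - 1) * ε ^ 3 * ρ := by rw [hQ]; ring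
      _ ≤ Q * ε ^ 2 * ρ := by
        have : (Q - 1) * ε ^ 3 ≤ Q * ε ^ 2 := by
          have : ε ^ 3 ≤ ε ^ 2 := pow_le_pow_of_le_one hε0.le hε1 (by norm_num)
          have : 0 < ε ^ 3 := by positivity
          nlinarith
        gcongr
      _ = (ε * Q) * (ε * ρ) := by ring
      _ ≤ _ := by gcongr
  have h9 : (κ * μm) * u z ≤ (κ * μm) * (ε * (ρ / 4)) := by linarith
  exact le_of_mul_le_mul_left h9 (by positivity)

lemma Ctx2.nondeg (c : Ctx2 D lam u ν B h μp μm) : ∃ ε > 0, ∃ ρ₀ > 0, ρ₀ ≤ 1 ∧ ∀ (x₀ : Euc d) (ρ : ℝ),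
    0 < ρ → ρ ≤ ρ₀ → closedBall x₀ ρ ⊆ B → x₀ ∈ frontier (Om D u) →
    ∃ z ∈ closedBall x₀ ρ, ε * ρ < u z := by
  obtain ⟨ε, hε, ρ₀, hρ₀, hρ1, H⟩ := c.decay
  have H2 : ∀ (y : Euc d) (ρ : ℝ),
    0 < ρ → ρ ≤ ρ₀ → closedBall y ρ ⊆ B → (∀ x ∈ closedBall y ρ, u x ≤ ε * ρ) → u y = 0 := by
    intro y ρ hρ hρρ hb hu
    have key : ∀ k : ℕ, ∀ z ∈ closedBall y (ρ / 4 ^ k), u z ≤ ε * (ρ / 4 ^ k) := by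
      intro k
      induction k with
      | zero => simpa using hu
      | succ k ih =>
        have hle : ρ / 4 ^ k ≤ ρ := div_le_self hρ.le (one_le_pow₀ (by norm_num))
        have := H y (ρ / 4 ^ k) (by positivity) (hle.trans hρρ)
          ((closedBall_subset_closedBall hle).trans hb) ih
        rwa [div_div, ← pow_succ] at this
    have hlim : Tendsto (fun k : ℕ => ε * (ρ / 4 ^ k)) atTop (𝓝 0) := by
      have : Tendsto (fun k : ℕ => (ε * ρ) * (1 / 4 : ℝ) ^ k) atTop (𝓝 ((ε * ρ) * 0)) :=
        (tendsto_pow_atTop_nhds_zero_of_lt_one (by norm_num) (by norm_num)).const_mul _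
      rw [mul_zero] at this
      refine this.congr fun k => ?_
      rw [one_div, inv_pow]; ring
    refine le_antisymm (ge_of_tendsto' hlim fun k => key k y ?_) (c.nn y)
    exact mem_closedBall_self (by positivity)
  refine ⟨ε / 2, by positivity, ρ₀, hρ₀, hρ1, fun x₀ ρ hρ hρρ hb hx => ?_⟩
  by_contra! hcon
  obtain ⟨y, hy, _, hy0⟩ := frontier_ne hx (by positivity : 0 < ρ / 2)
  have hsub : closedBall y (ρ / 2) ⊆ closedBall x₀ ρ := fun x hx => by
    rw [mem_closedBall] at hx ⊢
    rw [mem_ball] at hy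
    linarith [dist_triangle x y x₀]
  refine hy0 (H2 y (ρ / 2) (by positivity) (by linarith) (hsub.trans hb) fun x hx => ?_)
  have := hcon x (hsub hx)
  linarith

lemma Ctx.Af_ge (c : Ctx D lam u ν) {y z : Euc d} {ρ s : ℝ} (hρ : 0 < ρ)
    (hb : closedBall y ρ ⊆ D) (hs : closedBall z s ⊆ closedBall y (ρ / 2)) :
    ∫ x in closedBall z s, u x ≤ 2 * ρ ^ d * Af u y ρ := by
  have h1 := int_scale (fun x => u x * psi (ρ⁻¹ • (x - y))) y hρ
  have h2 : Af u y ρ = ∫ z, u (y + ρ • z) * psi (ρ⁻¹ • (y + ρ • z - y)) := by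
    unfold Af
    congr 1; ext z
    rw [add_sub_cancel_left, inv_smul_smul₀ hρ.ne']
  rw [h2, h1, mul_assoc, mul_inv_cancel_left₀ (by positivity), ← integral_const_mul,
    ← integral_indicator measurableSet_closedBall]
  have hsub : closedBall y (ρ / 2) ⊆ closedBall y ρ := closedBall_subset_closedBall (by linarith)
  have hp0 : ∀ x, x ∉ closedBall y ρ → psi (ρ⁻¹ • (x - y)) = 0 := by
    intro x hx
    apply psi_zero
    rw [mem_closedBall, not_le, dist_eq_norm] at hx
    rw [norm_smul, norm_inv, Real.norm_of_nonneg hρ.le, ← div_eq_inv_mul, le_div_iff₀ hρ]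
    linarith
  refine integral_mono_of_nonneg (Eventually.of_forall fun x => indicator_nonneg (fun x _ => c.nn x) _) ?_
      (Eventually.of_forall fun x => ?_)
  · refine Integrable.const_mul ?_ 2
    have hi : Integrable ((closedBall y ρ).indicator u) :=
      (integrable_indicator_iff measurableSet_closedBall).2 (c.u_intOn hb)
    refine hi.mono' (c.hm.1.1.mul (by have := psi_cont (d := d); exact (by fun_prop : Continuous _).aestronglyMeasurable))
      (Eventually.of_forall fun x => ?_)
    by_cases hx : x ∈ closedBall y ρ
    · rw [indicator_of_mem hx, Real.norm_of_nonneg (mul_nonneg (c.nn _) (psi_nonneg _))]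
      exact mul_le_of_le_one_right (c.nn _) (psi_le_one _)
    · rw [indicator_of_notMem hx, hp0 x hx]; simp
  · by_cases hx : x ∈ closedBall z s
    · simp only [indicator_of_mem hx]
      have hxy := hs hx
      rw [mem_closedBall, dist_eq_norm] at hxy
      have : 1 / 2 ≤ psi (ρ⁻¹ • (x - y)) := by
        refine le_max_of_le_left ?_
        have : ‖ρ⁻¹ • (x - y)‖ ≤ 1 / 2 := by
          rw [norm_smul, norm_inv, Real.norm_of_nonneg hρ.le, ← div_eq_inv_mul, div_le_iff₀ hρ]
          linarith
        nlinarith [norm_nonneg (ρ⁻¹ • (x - y))]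
      nlinarith [c.nn x]
    · simp only [indicator_of_notMem hx]
      exact mul_nonneg zero_le_two (mul_nonneg (c.nn _) (psi_nonneg _))

lemma Ctx2.A_lower (c : Ctx2 D lam u ν B h μp μm) : ∃ k > 0, ∃ ρ₀ > 0, ∀ (x₀ : Euc d) (r : ℝ),
    0 < r → r ≤ ρ₀ → closedBall x₀ r ⊆ B → x₀ ∈ frontier (Om D u) → k * r ≤ Af u x₀ r := by
  obtain ⟨ε, hε, ρ₀, hρ₀, hρ1, H⟩ := c.nondeg
  have hκ0 : 0 < ∫ z : Euc d, psi z := psi_pos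
  set κ := ∫ z : Euc d, psi z with hκ
  refine ⟨ε * κ / (Real.exp lam * (8 * 4 ^ d)), by positivity, ρ₀, hρ₀, fun x₀ r hr hr1 hb hx => ?_⟩
  obtain ⟨z, hz, hzu⟩ := H x₀ (r / 4) (by positivity) (by linarith)
    ((closedBall_subset_closedBall (by linarith)).trans hb) hx
  have hsub : closedBall z (r / 4) ⊆ closedBall x₀ (r / 2) := fun x hx => by
    rw [mem_closedBall] at hx hz ⊢
    linarith [dist_triangle x z x₀]
  have hbD := hb.trans c.hBD
  have hzD : closedBall z (r / 4) ⊆ D :=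
    (hsub.trans (closedBall_subset_closedBall (by linarith))).trans hbD
  have h2 := c.toCtx.submean (by positivity : 0 < r / 4) (by linarith) hzD
  have h3 := c.toCtx.Af_le (by positivity : 0 < r / 4) hzD
  have h4 := c.toCtx.Af_ge hr hbD hsub
  have h5 : ε * (r / 4) * κ ≤ Real.exp lam * (2 * 4 ^ d * Af u x₀ r) := by
    calc ε * (r / 4) * κ ≤ u z * κ := by gcongr
      _ ≤ _ := h2
      _ ≤ Real.exp lam * (((r / 4) ^ d)⁻¹ * (2 * r ^ d * Af u x₀ r)) := by
        gcongr
        exact h3.trans (by gcongr)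
      _ = _ := by rw [div_pow]; field_simp
  rw [div_mul_eq_mul_div, div_le_iff₀ (by positivity)]
  linarith
end nondeg

end part7

section part8

section lower
variable {D B : Set (Euc d)} {lam h μp μm : ℝ} {u : Euc d → ℝ} {ν : Measure (Euc d)}

lemma Ctx.A_diff_le (c : Ctx D lam u ν) {y : Euc d} {ρ p q M : ℝ} (hb : closedBall y ρ ⊆ D)
    (hp : 0 ≤ p) (hpq : p ≤ q) (hq : q ≤ ρ)
    (hM : ∀ s, p < s → s < q → (1 / 4) * s * (s ^ d)⁻¹ * (ν (ball y s)).toReal ≤ M) :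
    Af u y q - Af u y p ≤ M * (q - p) := by
  have hd : ∀ s ∈ interior (Icc p q), ∃ A', HasDerivAt (Af u y) A' s ∧ A' ≤ M := by
    intro s hs
    rw [interior_Icc] at hs
    obtain ⟨A', h1, h2, _⟩ := c.deriv_bounds hb (hp.trans_lt hs.1) (hs.2.trans_le hq)
    exact ⟨A', h1, h2.trans (hM s hs.1 hs.2)⟩
  refine Convex.image_sub_le_mul_sub_of_deriv_le (convex_Icc p q)
    ((Af_contOn c.lip hb).mono (Icc_subset_Icc hp hq)) ?_ ?_ p (left_mem_Icc.2 hpq) q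
    (right_mem_Icc.2 hpq) hpq
  · intro s hs
    obtain ⟨A', h1, _⟩ := hd s hs
    exact h1.differentiableAt.differentiableWithinAt
  · intro s hs
    obtain ⟨A', h1, h2⟩ := hd s hs
    rwa [h1.deriv]

lemma Ctx2.lower (c : Ctx2 D lam u ν B h μp μm) : ∃ C₁ > 0, ∃ r₀ > 0, ∀ (x₀ : Euc d) (r : ℝ),
    x₀ ∈ frontier (Om D u) → 0 < r → r ≤ r₀ → ball x₀ r ⊆ B →
    ENNReal.ofReal (C₁ * r ^ (d - 1)) ≤ ν (ball x₀ r) := by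
  obtain ⟨k, hk, ρ₀, hρ₀, HA⟩ := c.A_lower
  obtain ⟨C, hC, r₁, hr₁, HU⟩ := c.up_ball
  set ε := min (1 / 2) (2 * k / C) with hε
  have hε0 : 0 < ε := by positivity
  have hε1 : ε ≤ 1 / 2 := min_le_left _ _
  have hε2 : ε * C ≤ 2 * k := by
    have : ε ≤ 2 * k / C := min_le_right _ _
    rwa [le_div_iff₀ hC] at this
  refine ⟨2 * k * (ε / 2) ^ (d - 1), by positivity, min ρ₀ r₁, by positivity, ?_⟩
  intro x₀ r hx hr hr0 hb
  have hrρ := hr0.trans (min_le_left _ _)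
  have hrr := hr0.trans (min_le_right _ _)
  set R := r / 2 with hR
  have hR0 : 0 < R := by positivity
  have hbR : closedBall x₀ R ⊆ B := (closedBall_subset_ball (by linarith)).trans hb
  have hbD := hbR.trans c.hBD
  have h0 : u x₀ = 0 := frontier_zero c.hD c.lip hx (hbD (mem_closedBall_self hR0.le))
  have hA := HA x₀ R hR0 (by linarith) hbR hx
  have hs : ∀ s : ℝ, 0 < s → s * (s ^ d)⁻¹ = (s ^ (d - 1))⁻¹ := by
    intro s hs
    have e : s ^ d = s * s ^ (d - 1) := by
      rw [← pow_succ', Nat.sub_add_cancel c.dpos]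
    rw [e]; field_simp
  have hεR : ε * R ≤ R := by nlinarith
  set N := (ν (ball x₀ R)).toReal with hN
  have hfin : ν (ball x₀ R) < ⊤ := (measure_mono ball_subset_closedBall).trans_lt
    (c.fin _ (isCompact_closedBall _ _) hbD)
  have d1 := c.toCtx.A_diff_le (p := 0) (q := ε * R) (M := C / 4) hbD le_rfl (by positivity) hεR (by
    intro s hs0 hs1
    have h1 := HU x₀ s hs0 (by linarith) ((closedBall_subset_closedBall (by nlinarith)).trans hbR)
    rw [mul_assoc (1 / 4 : ℝ), hs s hs0]
    calc 1 / 4 * (s ^ (d - 1))⁻¹ * (ν (ball x₀ s)).toReal ≤ 1 / 4 * (s ^ (d - 1))⁻¹ * (C * s ^ (d - 1)) := by gcongr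
      _ = C / 4 := by field_simp)
  have d2 := c.toCtx.A_diff_le (p := ε * R) (q := R) (M := 1 / 4 * ((ε * R) ^ (d - 1))⁻¹ * N) hbD (by positivity) hεR le_rfl (by
    intro s hs0 hs1
    have hsp : 0 < s := lt_trans (by positivity) hs0
    rw [mul_assoc (1 / 4 : ℝ), hs s hsp]
    have h1 : (ν (ball x₀ s)).toReal ≤ N := ENNReal.toReal_mono hfin.ne (measure_mono (ball_subset_ball hs1.le))
    gcongr)
  rw [Af_zero, h0, zero_mul] at d1
  have hN0 : 0 ≤ N := ENNReal.toReal_nonneg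
  have d3 : 1 / 4 * ((ε * R) ^ (d - 1))⁻¹ * N * (R - ε * R) ≤ 1 / 4 * ((ε * R) ^ (d - 1))⁻¹ * N * R := by
    gcongr
    linarith [mul_pos hε0 hR0]
  have d4 : R * (k / 2) ≤ R * (1 / 4 * ((ε * R) ^ (d - 1))⁻¹ * N) := by nlinarith
  have d5 := le_of_mul_le_mul_left d4 hR0
  have d6 : 2 * k * (ε * R) ^ (d - 1) ≤ N := by
    have hp : 0 < (ε * R) ^ (d - 1) := by positivity
    have := mul_le_mul_of_nonneg_left d5 hp.le
    have e : (ε * R) ^ (d - 1) * (1 / 4 * ((ε * R) ^ (d - 1))⁻¹ * N) = N / 4 := by field_simp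
    rw [e] at this
    linarith
  have e : 2 * k * (ε / 2) ^ (d - 1) * r ^ (d - 1) = 2 * k * (ε * R) ^ (d - 1) := by
    rw [mul_assoc, ← mul_pow, hR]; ring_nf
  rw [e]
  calc _ ≤ ENNReal.ofReal N := ENNReal.ofReal_le_ofReal d6
    _ = ν (ball x₀ R) := ENNReal.ofReal_toReal hfin.ne
    _ ≤ _ := measure_mono (ball_subset_ball (by linarith))
end lower

end part8

section part9

section upper2
variable {D B : Set (Euc d)} {lam h μp μm : ℝ} {u : Euc d → ℝ} {ν : Measure (Euc d)}

lemma box_vol (hd : 0 < d) {e p : Euc d} (he : ‖e‖ = 1) {δ ρ : ℝ} (hδ : 0 ≤ δ) (hρ : 0 ≤ ρ)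
    {S : Set (Euc d)} (hS : ∀ x ∈ S, |⟪x - p, e⟫| ≤ δ ∧ ‖x - p‖ ≤ ρ) :
    mvol S ≤ 2 * δ * (2 * ρ) ^ (d - 1) := by
  classical
  set i₀ : Fin d := ⟨0, hd⟩
  have hv : Orthonormal ℝ (({i₀} : Set (Fin d)).restrict fun _ => e) := by
    constructor
    · intro i; exact he
    · intro i j hij
      exact absurd (Subsingleton.elim i j) hij
  obtain ⟨b, hb⟩ := hv.exists_orthonormalBasis_extension_of_card_eq (by simp)
  have hb0 : b i₀ = e := hb i₀ rfl
  set cc : Fin d → ℝ := fun i => if i = i₀ then δ else ρ with hcc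
  set T : Set (Fin d → ℝ) := Icc (fun i => - cc i) cc with hT
  have h1 : S ⊆ (fun x => x - p) ⁻¹' (b.repr ⁻¹' ((WithLp.ofLp) ⁻¹' T)) := by
    intro x hx
    obtain ⟨h1, h2⟩ := hS x hx
    have : ∀ i, |b.repr (x - p) i| ≤ cc i := by
      intro i
      rw [b.repr_apply_apply]
      by_cases hi : i = i₀
      · simp only [hcc, hi, if_true, hb0]
        rwa [real_inner_comm]
      · simp only [hcc, hi, if_false]
        refine (abs_real_inner_le_norm _ _).trans ?_
        rw [b.orthonormal.1 i, one_mul]; exact h2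
    simp only [mem_preimage, hT, mem_Icc, Pi.le_def]
    exact ⟨fun i => (abs_le.1 (this i)).1, fun i => (abs_le.1 (this i)).2⟩
  have hTm : MeasurableSet T := measurableSet_Icc
  have h2 : volume ((fun x => x - p) ⁻¹' (b.repr ⁻¹' ((WithLp.ofLp) ⁻¹' T))) = volume T := by
    have hsub : (fun x : Euc d => x - p) = fun x => x + (-p) := by ext1 x; rw [sub_eq_add_neg]
    rw [hsub, measure_preimage_add_right]
    have m2 := (PiLp.volume_preserving_ofLp (Fin d)).measure_preimage hTm.nullMeasurableSet
    rw [← m2]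
    exact b.measurePreserving_repr.measure_preimage
      ((PiLp.volume_preserving_ofLp (Fin d)).measurable hTm).nullMeasurableSet
  have h3 : volume T = ENNReal.ofReal (2 * δ * (2 * ρ) ^ (d - 1)) := by
    rw [hT, Real.volume_Icc_pi, ← ENNReal.ofReal_prod_of_nonneg]
    · congr 1
      have : ∀ i, cc i - - cc i = if i = i₀ then 2 * δ else 2 * ρ := by
        intro i; simp only [hcc]; split_ifs <;> ring
      simp only [this]
      rw [← Finset.mul_prod_erase _ _ (Finset.mem_univ i₀), if_pos rfl]
      congr 1
      rw [Finset.prod_congr rfl (g := fun _ => 2 * ρ) (fun i hi => if_neg (Finset.ne_of_mem_erase hi))]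
      simp
    · intro i _
      simp only [hcc]; split_ifs <;> linarith
  unfold mvol
  calc (volume S).toReal ≤ (volume T).toReal := by
        refine ENNReal.toReal_mono (by rw [h3]; simp) ?_
        rw [← h2]; exact measure_mono h1
    _ = _ := by rw [h3, ENNReal.toReal_ofReal (by positivity)]

lemma Ctx2.upper_ge2 {xc : Euc d} {R : ℝ} (hR : 0 < R) (c : Ctx2 D lam u ν (ball xc R) h μp μm)
    (hd2 : 2 ≤ d) : ∃ C₂ > 0, ∃ r₀ > 0, ∀ (x₀ : Euc d) (r : ℝ),
    0 < r → r ≤ r₀ → ball x₀ r ⊆ ball xc R →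
    ν (ball x₀ r) ≤ ENNReal.ofReal (C₂ * r ^ (d - 1)) := by
  obtain ⟨r₁, hr₁, hsm⟩ := small_ball c.dpos c.hpos
  have hμp := c.μp0
  set C := (1 + μp) * 48 * 6 ^ (d - 1) with hC
  have hC0 : 0 < C := by positivity
  refine ⟨C * 2, by positivity, min (R / 4) (r₁ / 3), by positivity, ?_⟩
  intro x₀ r hr hr0 hb
  have hrR : r ≤ R / 4 := hr0.trans (min_le_left _ _)
  have hrr : r ≤ r₁ / 3 := hr0.trans (min_le_right _ _)
  haveI : Nontrivial (Euc d) := by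
    haveI : Nonempty (Fin d) := ⟨⟨0, c.dpos⟩⟩
    infer_instance
  set m := ‖x₀ - xc‖ with hm
  have hm0 : 0 ≤ m := norm_nonneg _
  obtain ⟨e, he, hme⟩ : ∃ e : Euc d, ‖e‖ = 1 ∧ x₀ - xc = m • e := by
    by_cases h0 : x₀ - xc = 0
    · obtain ⟨e, he⟩ := exists_norm_eq (Euc d) zero_le_one
      exact ⟨e, he, by rw [hm, h0]; simp⟩
    · refine ⟨m⁻¹ • (x₀ - xc), ?_, ?_⟩
      · rw [norm_smul, norm_inv, norm_norm, inv_mul_cancel₀ (norm_ne_zero_iff.2 h0)]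
      · rw [smul_inv_smul₀ (norm_ne_zero_iff.2 h0)]
  have hmr : m + r ≤ R := by
    by_contra! hcon
    have ht : R - m < r := by linarith
    have hRm : 0 < R - m := by
      have := hb (mem_ball_self hr)
      rw [mem_ball, dist_eq_norm] at this
      linarith
    have h1 : x₀ + (R - m) • e ∈ ball x₀ r := by
      rw [mem_ball, dist_self_add_left, norm_smul, he, mul_one, Real.norm_of_nonneg hRm.le]; exact ht
    have h2 := hb h1
    rw [mem_ball, dist_eq_norm] at h2
    have e3 : x₀ + (R - m) • e - xc = R • e := by
      have : x₀ + (R - m) • e - xc = (x₀ - xc) + (R - m) • e := by abel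
      rw [this, hme, ← add_smul]; congr 1; ring
    rw [e3, norm_smul, he, mul_one, Real.norm_of_nonneg hR.le] at h2
    exact lt_irrefl _ h2
  set p := x₀ + r • e with hp
  -- facts for points of the ball
  have facts : ∀ x ∈ ball x₀ r, 0 < ⟪p - x, e⟫ ∧ ⟪p - x, e⟫ ≤ 2 * r ∧
      ‖x - p‖ ^ 2 ≤ 2 * r * ⟪p - x, e⟫ ∧ ‖x - xc‖ ≤ R - ⟪p - x, e⟫ / 4 := by
    intro x hx
    rw [mem_ball, dist_eq_norm] at hx
    set z := x - x₀ with hz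
    have hee : ⟪e, e⟫ = (1 : ℝ) := by rw [real_inner_self_eq_norm_sq, he]; norm_num
    have hτ : ⟪p - x, e⟫ = r - ⟪z, e⟫ := by
      have : p - x = r • e - z := by rw [hp, hz]; abel
      rw [this, inner_sub_left, real_inner_smul_left, hee, mul_one]
    have hze := abs_real_inner_le_norm z e
    rw [he, mul_one] at hze
    have hze' := abs_le.1 hze
    have hz0 := norm_nonneg z
    have hx1 : ‖x - p‖ ^ 2 = ‖z‖ ^ 2 - 2 * r * ⟪z, e⟫ + r ^ 2 := by
      have : x - p = z - r • e := by rw [hp, hz]; abel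
      rw [this, norm_sub_sq_real, inner_smul_right, norm_smul, he, Real.norm_of_nonneg hr.le]; ring
    have hx2 : ‖x - xc‖ ^ 2 = ‖z‖ ^ 2 + 2 * m * ⟪z, e⟫ + m ^ 2 := by
      have : x - xc = z + m • e := by rw [← hme, hz]; abel
      rw [this, norm_add_sq_real, inner_smul_right, norm_smul, he, Real.norm_of_nonneg hm0]; ring
    rw [hτ]
    refine ⟨by linarith, by linarith, by nlinarith, ?_⟩
    by_cases hmR : R / 4 ≤ m
    · refine le_of_sq_le_sq ?_ (by linarith)
      rw [hx2]
      nlinarith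
    · have h1 : ‖x - xc‖ ≤ ‖z‖ + m := by
        have : x - xc = z + (x₀ - xc) := by rw [hz]; abel
        rw [this]; exact norm_add_le _ _
      push Not at hmR
      linarith
  set E : ℕ → Set (Euc d) := fun j => {x ∈ ball x₀ r | 2 * r * (1 / 4) ^ (j + 1) ≤ ⟪p - x, e⟫ ∧
    ⟪p - x, e⟫ ≤ 2 * r * (1 / 4) ^ j} with hE
  have hcov : ball x₀ r ⊆ ⋃ j, E j := by
    intro x hx
    obtain ⟨f1, f2, -, -⟩ := facts x hx
    obtain ⟨n, hn1, hn2⟩ := exists_nat_pow_near_of_lt_one (x := ⟪p - x, e⟫ / (2 * r)) (y := (1 / 4 : ℝ))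
      (by positivity) (by rw [div_le_one (by positivity)]; exact f2) (by norm_num) (by norm_num)
    refine mem_iUnion.2 ⟨n, hx, ?_, ?_⟩
    · rw [lt_div_iff₀ (by positivity)] at hn1; linarith
    · rw [div_le_iff₀ (by positivity)] at hn2; linarith
  have hEj : ∀ j, ν (E j) ≤ ENNReal.ofReal (C * r ^ (d - 1) * (1 / 2) ^ j) := by
    intro j
    set q : ℝ := (1 / 2) ^ j with hq
    have hq0 : 0 < q := by positivity
    have hq1 : q ≤ 1 := pow_le_one₀ (by norm_num) (by norm_num)
    have hq4 : (1 / 4 : ℝ) ^ j = q ^ 2 := by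
      rw [hq, ← pow_mul, mul_comm, pow_mul]; norm_num
    set S : Set (Euc d) := closedBall xc (R - q ^ 2 * r / 16) ∩ {x | |⟪x - p, e⟫| ≤ 3 * q ^ 2 * r ∧ ‖x - p‖ ≤ 3 * q * r} with hS
    have hSc : IsCompact S := by
      refine (isCompact_closedBall xc _).inter_right ?_
      have hc1 : Continuous fun x : Euc d => |⟪x - p, e⟫| := by fun_prop
      have hc2 : Continuous fun x : Euc d => ‖x - p‖ := by fun_prop
      exact (isClosed_le hc1 continuous_const).inter (isClosed_le hc2 continuous_const)
    have hq2 : 0 < q ^ 2 * r := by positivity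
    have hSB : S ⊆ ball xc R := fun x hx => (closedBall_subset_ball (by linarith)) hx.1
    have hEf : ∀ x ∈ E j, q ^ 2 * r / 2 ≤ ⟪p - x, e⟫ ∧ ⟪p - x, e⟫ ≤ 2 * q ^ 2 * r ∧
        ‖x - p‖ ≤ 2 * q * r ∧ ‖x - xc‖ ≤ R - q ^ 2 * r / 8 := by
      rintro x ⟨hx, h1, h2⟩
      obtain ⟨f1, f2, f3, f4⟩ := facts x hx
      rw [pow_succ, hq4] at h1
      rw [hq4] at h2
      refine ⟨by linarith, by linarith, ?_, by linarith⟩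
      refine le_of_sq_le_sq ?_ (by positivity)
      nlinarith
    have hES : ∀ x, infDist x (E j) < q ^ 2 * r / 16 → (E j).Nonempty → x ∈ S := by
      intro x hx hne
      obtain ⟨y, hy, hxy⟩ := (infDist_lt_iff hne).1 hx
      obtain ⟨g1, g2, g3, g4⟩ := hEf y hy
      rw [dist_eq_norm] at hxy
      refine ⟨?_, ?_, ?_⟩
      · rw [mem_closedBall, dist_eq_norm]
        have : x - xc = (x - y) + (y - xc) := by abel
        rw [this]
        refine (norm_add_le _ _).trans ?_
        linarith
      · have : x - p = (x - y) - (p - y) := by abel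
        rw [this, inner_sub_left]
        have h5 := abs_real_inner_le_norm (x - y) e
        rw [he, mul_one] at h5
        have h6 := abs_sub (⟪x - y, e⟫ : ℝ) ⟪p - y, e⟫
        rw [abs_of_nonneg (by linarith : (0 : ℝ) ≤ ⟪p - y, e⟫)] at h6
        linarith
      · have : x - p = (x - y) + (y - p) := by abel
        rw [this]
        refine (norm_add_le _ _).trans ?_
        have : q ^ 2 * r ≤ q * r := by gcongr; nlinarith
        linarith
    rcases (E j).eq_empty_or_nonempty with hemp | hne
    · rw [hemp]; simp
    have hSv : mvol S ≤ 2 * (3 * q ^ 2 * r) * (2 * (3 * q * r)) ^ (d - 1) :=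
      box_vol c.dpos he (by positivity) (by positivity) fun x hx => hx.2
    have hSh : mvol S ≤ h := by
      refine (mvol_mono (fun x hx => ?_) measure_closedBall_lt_top).trans (hsm p (3 * r) (by positivity) (by linarith))
      have := hx.2.2
      rw [mem_closedBall, dist_eq_norm]
      nlinarith
    have h1 := c.up_thick (E := E j) (t := q ^ 2 * r / 16) (by positivity) hSc hSB (fun x hx => hES x hx hne) hSh
    have hfin : ν (E j) < ⊤ := by
      refine (measure_mono fun x hx => ?_).trans_lt (c.fin S hSc (hSB.trans c.hBD))
      exact hES x (by rw [infDist_zero_of_mem hx]; positivity) hne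
    rw [← ENNReal.ofReal_toReal hfin.ne]
    refine ENNReal.ofReal_le_ofReal ?_
    have h2 : (q ^ 2 * r) * (ν (E j)).toReal ≤ (q ^ 2 * r) * (C * r ^ (d - 1) * q ^ (d - 1)) := by
      have h3 := mul_le_mul_of_nonneg_left hSv (by positivity : 0 ≤ 1 + μp)
      have e1 : (1 + μp) * (2 * (3 * q ^ 2 * r) * (2 * (3 * q * r)) ^ (d - 1)) =
        (q ^ 2 * r) * (C * r ^ (d - 1) * q ^ (d - 1)) / 8 := by
        have : 2 * (3 * q * r) = 6 * q * r := by ring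
        rw [this, mul_pow, mul_pow, hC]; ring
      rw [e1] at h3
      linarith
    have h4 := le_of_mul_le_mul_left h2 hq2
    refine h4.trans ?_
    gcongr
    exact pow_le_of_le_one hq0.le hq1 (by omega)
  calc ν (ball x₀ r) ≤ ν (⋃ j, E j) := measure_mono hcov
    _ ≤ ∑' j, ν (E j) := measure_iUnion_le _
    _ ≤ ∑' j : ℕ, ENNReal.ofReal (C * r ^ (d - 1) * (1 / 2) ^ j) := ENNReal.tsum_le_tsum hEj
    _ = ENNReal.ofReal (∑' j : ℕ, C * r ^ (d - 1) * (1 / 2) ^ j) := by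
        rw [ENNReal.ofReal_tsum_of_nonneg (fun j => by positivity) (summable_geometric_two.mul_left _)]
    _ = _ := by
        rw [tsum_mul_left, tsum_geometric_two]; congr 1; ring
end upper2

end part9

section part10

section d1
variable {D : Set (Euc d)} {lam : ℝ} {u : Euc d → ℝ} {ν : Measure (Euc d)}

lemma memLp_cont_bdd (hDb : Bornology.IsBounded D) (hD : IsOpen D) {P : Euc d → ℝ} (hP : Continuous P) (p : ℝ≥0∞) :
    MemLp P p (volume.restrict D) := by
  obtain ⟨C, hC⟩ := hDb.isCompact_closure.exists_bound_of_continuousOn hP.continuousOn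
  haveI : IsFiniteMeasure (volume.restrict D) := ⟨by
    rw [Measure.restrict_apply_univ]; exact hDb.measure_lt_top⟩
  refine MemLp.of_bound hP.aestronglyMeasurable C ?_
  exact (ae_restrict_mem hD.measurableSet).mono fun x hx => hC x (subset_closure hx)

lemma d1_I (hm : MemH10 D u) (hD : IsOpen D) (hDb : Bornology.IsBounded D) (nn : ∀ x, 0 ≤ u x)
    {e : Euc d} (he : ‖e‖ = 1) {P Q : Euc d → ℝ} (hP : Differentiable ℝ P) (hQ : Continuous Q)
    (hPQ : ∀ x, fderiv ℝ P x e = Q x) (hQ0 : ∀ x, Q x ≤ 0) :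
    0 ≤ ∫ x in D, ⟪gradient u x, e⟫ * P x := by
  obtain ⟨hu1, hu2, ψ, hψ, hlim⟩ := hm
  have mP := memLp_cont_bdd hDb hD hP.continuous 2
  have mQ := memLp_cont_bdd hDb hD hQ 2
  have mu := hu1.restrict D
  have mg := hu2.restrict D
  have mge : ∀ {V : Euc d → Euc d}, MemLp V 2 (volume.restrict D) →
      MemLp (fun x => ⟪V x, e⟫) 2 (volume.restrict D) := fun hV => hV.inner_const e
  set C := ∫ x in D, (P x ^ 2 + Q x ^ 2) with hC
  have key : ∀ t : ℝ, 0 < t → ∀ n, - (t / 2 * (∫ x, ((u x - ψ n x) ^ 2 + ‖gradient u x - gradient (ψ n) x‖ ^ 2)))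
      - 1 / (2 * t) * C ≤ ∫ x in D, ⟪gradient u x, e⟫ * P x := by
    intro t ht n
    obtain ⟨K, hK⟩ := testFun_lip (hψ n)
    have p1 := memLp_lip hK (hψ n).2.1 2
    have p2 := memLp_grad hK (hψ n).2.1 2
    have iE : Integrable fun x => ((u x - ψ n x) ^ 2 + ‖gradient u x - gradient (ψ n) x‖ ^ 2) :=
      (hu1.sub p1).integrable_sq.add ((hu2.sub p2).integrable_norm_pow (p := 2) (by norm_num))
    have hz : ∀ x, x ∉ D → ψ n x = 0 := fun x hx =>
      image_eq_zero_of_notMem_tsupport fun h => hx ((hψ n).2.2 h)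
    have hzg : ∀ x, x ∉ D → gradient (ψ n) x = 0 := fun x hx =>
      gradient_zero_off fun h => hx ((hψ n).2.2 h)
    have i1 : IntegrableOn (fun x => ⟪gradient (ψ n) x, e⟫ * P x) D :=
      (mge (p2.restrict D)).integrable_mul mP
    have i2 : IntegrableOn (fun x => ψ n x * Q x) D := (p1.restrict D).integrable_mul mQ
    have i0 : IntegrableOn (fun x => ψ n x * P x) D := (p1.restrict D).integrable_mul mP
    have i3 : IntegrableOn (fun x => ⟪gradient u x, e⟫ * P x) D := (mge mg).integrable_mul mP
    have i4 : IntegrableOn (fun x => u x * Q x) D := mu.integrable_mul mQ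
    have glob : ∀ {F : Euc d → ℝ}, (∀ x, x ∉ D → F x = 0) → IntegrableOn F D → Integrable F := by
      intro F hF hi
      exact (integrableOn_iff_integrable_of_support_subset (fun x hx => by
        by_contra h; exact hx (hF x h))).1 hi
    have ibp : ∫ x in D, ⟪gradient (ψ n) x, e⟫ * P x = - ∫ x in D, ψ n x * Q x := by
      rw [setIntegral_eq_integral_of_forall_compl_eq_zero (fun x hx => by rw [hzg x hx]; simp),
        setIntegral_eq_integral_of_forall_compl_eq_zero (fun x hx => by rw [hz x hx]; simp)]
      have := integral_mul_fderiv_eq_neg_fderiv_mul_of_integrable (μ := (volume : Measure (Euc d)))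
        (f := ψ n) (g := P) (v := e) ?_ ?_ ?_ ?_ ?_
      · simp only [hPQ, ← inner_grad] at this
        simp only [inner_grad] at this ⊢
        rw [this, neg_neg]
      · simp only [← inner_grad]
        exact glob (fun x hx => by rw [hzg x hx]; simp) i1
      · simp only [hPQ]
        exact glob (fun x hx => by rw [hz x hx]; simp) i2
      · exact glob (fun x hx => by rw [hz x hx]; simp) i0
      · intro x _; exact ((hψ n).1.differentiable (by simp)) x
      · intro x _; exact hP x
    have h1 : ∫ x in D, (u x * Q x) ≤ 0 :=
      integral_nonpos fun x => mul_nonpos_of_nonneg_of_nonpos (nn x) (hQ0 x)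
    have iC : IntegrableOn (fun x => P x ^ 2 + Q x ^ 2) D := mP.integrable_sq.add mQ.integrable_sq
    have h2 : ∫ x in D, ((-(t / 2)) * ((u x - ψ n x) ^ 2 + ‖gradient u x - gradient (ψ n) x‖ ^ 2)
        - 1 / (2 * t) * (P x ^ 2 + Q x ^ 2)) ≤
        ∫ x in D, ((⟪gradient u x, e⟫ * P x - ⟪gradient (ψ n) x, e⟫ * P x) + (u x * Q x - ψ n x * Q x)) := by
      refine integral_mono (((iE.integrableOn).const_mul _).sub (iC.const_mul _))
        ((i3.sub i1).add (i4.sub i2)) fun x => ?_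
      have hab : ∀ a b : ℝ, -(t / 2) * a ^ 2 - 1 / (2 * t) * b ^ 2 ≤ a * b := by
        intro a b
        have : a * b - (-(t / 2) * a ^ 2 - 1 / (2 * t) * b ^ 2) = (t * a + b) ^ 2 / (2 * t) := by
          field_simp; ring
        have h' : 0 ≤ (t * a + b) ^ 2 / (2 * t) := by positivity
        linarith
      have e1 := hab (⟪gradient u x - gradient (ψ n) x, e⟫) (P x)
      have e2 := hab (u x - ψ n x) (Q x)
      have e3 : ⟪gradient u x - gradient (ψ n) x, e⟫ ^ 2 ≤ ‖gradient u x - gradient (ψ n) x‖ ^ 2 := by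
        have := abs_real_inner_le_norm (gradient u x - gradient (ψ n) x) e
        rw [he, mul_one] at this
        rw [← sq_abs]; gcongr
      have e4 : t / 2 * ⟪gradient u x - gradient (ψ n) x, e⟫ ^ 2 ≤ t / 2 * ‖gradient u x - gradient (ψ n) x‖ ^ 2 := by
        gcongr
      rw [inner_sub_left] at e1 e4
      simp only
      linarith
    have i31 : Integrable (fun x => ⟪gradient u x, e⟫ * P x - ⟪gradient (ψ n) x, e⟫ * P x)
      (volume.restrict D) := i3.sub i1
    have i42 : Integrable (fun x => u x * Q x - ψ n x * Q x) (volume.restrict D) := i4.sub i2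
    rw [integral_add i31 i42, integral_sub i3 i1, integral_sub i4 i2, ibp,
      integral_sub ((iE.integrableOn).const_mul _) (iC.const_mul _), integral_const_mul, integral_const_mul] at h2
    have h3 : ∫ x in D, ((u x - ψ n x) ^ 2 + ‖gradient u x - gradient (ψ n) x‖ ^ 2) ≤
        ∫ x, ((u x - ψ n x) ^ 2 + ‖gradient u x - gradient (ψ n) x‖ ^ 2) :=
      setIntegral_le_integral iE (Eventually.of_forall fun x => by simp only [Pi.zero_apply]; positivity)
    have h4 := mul_le_mul_of_nonneg_left h3 (by positivity : 0 ≤ t / 2)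
    linarith
  have key2 : ∀ t : ℝ, 0 < t → - (1 / (2 * t) * C) ≤ ∫ x in D, ⟪gradient u x, e⟫ * P x := by
    intro t ht
    have : Tendsto (fun n => - (t / 2 * (∫ x, ((u x - ψ n x) ^ 2 + ‖gradient u x - gradient (ψ n) x‖ ^ 2)))
      - 1 / (2 * t) * C) atTop (𝓝 (- (t / 2 * 0) - 1 / (2 * t) * C)) :=
      ((hlim.const_mul _).neg).sub_const _
    have := le_of_tendsto' this (key t ht)
    linarith
  have : Tendsto (fun t : ℝ => - (1 / 2 * C * t⁻¹)) atTop (𝓝 (-(1 / 2 * C * 0))) :=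
    (tendsto_inv_atTop_zero.const_mul _).neg
  rw [mul_zero, neg_zero] at this
  refine le_of_tendsto this ?_
  filter_upwards [eventually_gt_atTop 0] with t ht
  have h := key2 t ht
  have h' : 1 / 2 * C * t⁻¹ = 1 / (2 * t) * C := by field_simp
  rw [h']; exact h

end d1

end part10

section part11

section d1b
variable {D : Set (Euc 1)} {lam : ℝ} {u : Euc 1 → ℝ} {ν : Measure (Euc 1)}

lemma inner_one (v w : Euc 1) : ⟪v, w⟫ = ⟪v, EuclideanSpace.single 0 1⟫ * ⟪w, EuclideanSpace.single 0 1⟫ := by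
  simp [PiLp.inner_apply, mul_comm]

def clip (t : ℝ) : ℝ := max (-1) (min t 1)

lemma clip_lip : LipschitzWith 1 clip := by
  have := (LipschitzWith.id (α := ℝ)).min_const 1 |>.const_max (-1)
  exact this

lemma clip_abs (t : ℝ) : |clip t| ≤ 1 := by
  unfold clip; rw [abs_le]; exact ⟨le_max_left _ _, max_le (by norm_num) (min_le_right _ _)⟩

lemma clip_of_lt {t : ℝ} (h : |t| < 1) : clip t = t := by
  rw [abs_lt] at h
  unfold clip; rw [min_eq_left h.2.le, max_eq_right h.1.le]

lemma clip_of_ge {t : ℝ} (h : 1 ≤ |t|) : |clip t| = 1 := by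
  unfold clip
  rcases le_abs.1 h with h | h
  · rw [min_eq_right h]; norm_num
  · rw [min_eq_left (by linarith), max_eq_left (by linarith)]; norm_num

def gk (p L : ℝ) (k : ℕ) (η : ℝ) (x : Euc 1) : ℝ := max (1 - η - (clip ((x 0 - p) / L)) ^ (2 * k + 2)) 0

lemma s_lip (p : ℝ) {L : ℝ} (hL : 0 < L) : LipschitzWith (Real.toNNReal L⁻¹) (fun x : Euc 1 => (x 0 - p) / L) := by
  refine LipschitzWith.of_dist_le_mul fun x y => ?_
  rw [Real.coe_toNNReal _ (by positivity), Real.dist_eq, dist_eq_norm]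
  have : (x 0 - p) / L - (y 0 - p) / L = L⁻¹ * ((x - y) 0) := by
    simp only [PiLp.sub_apply]; field_simp; ring
  rw [this, abs_mul, abs_of_pos (by positivity : 0 < L⁻¹)]
  gcongr
  exact PiLp.norm_apply_le (x - y) 0

lemma s_deriv (p L : ℝ) (x : Euc 1) :
    HasFDerivAt (fun x : Euc 1 => (x 0 - p) / L) (L⁻¹ • (EuclideanSpace.proj (0 : Fin 1) : Euc 1 →L[ℝ] ℝ)) x := by
  have h := (((EuclideanSpace.proj (0 : Fin 1) : Euc 1 →L[ℝ] ℝ).hasFDerivAt (x := x)).sub_const p).const_mul L⁻¹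
  refine h.congr_of_eventuallyEq (Eventually.of_forall fun y => ?_)
  simp [div_eq_inv_mul]

lemma gk_lip (p : ℝ) {L : ℝ} (hL : 0 < L) (k : ℕ) : ∃ K, ∀ η, LipschitzWith K (gk p L k η) := by
  refine ⟨Real.toNNReal ((2 * k + 2 : ℕ) : ℝ) * (1 * Real.toNNReal L⁻¹), fun η => ?_⟩
  have hc := clip_lip.comp (s_lip p hL)
  have hp : LipschitzWith (Real.toNNReal ((2 * k + 2 : ℕ) : ℝ) * (1 * Real.toNNReal L⁻¹))
      fun x : Euc 1 => 1 - η - (clip ((x 0 - p) / L)) ^ (2 * k + 2) := by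
    refine LipschitzWith.of_dist_le_mul fun x y => ?_
    have h1 := hc.dist_le_mul x y
    simp only [Function.comp, Real.dist_eq] at h1
    set a := clip ((x 0 - p) / L)
    set b := clip ((y 0 - p) / L)
    have h2 := abs_pow_sub_pow_le b a (2 * k + 2)
    have h3 : max |b| |a| ^ (2 * k + 2 - 1) ≤ 1 :=
      pow_le_one₀ (le_max_of_le_left (abs_nonneg _)) (max_le (clip_abs _) (clip_abs _))
    rw [Real.dist_eq]
    have e : 1 - η - a ^ (2 * k + 2) - (1 - η - b ^ (2 * k + 2)) = b ^ (2 * k + 2) - a ^ (2 * k + 2) := by ring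
    rw [e, NNReal.coe_mul, Real.coe_toNNReal _ (by positivity)]
    rw [abs_sub_comm] at h1
    calc _ ≤ _ := h2
      _ ≤ |b - a| * ((2 * k + 2 : ℕ) : ℝ) * 1 := by gcongr
      _ = ((2 * k + 2 : ℕ) : ℝ) * |b - a| := by ring
      _ ≤ ((2 * k + 2 : ℕ) : ℝ) * (((1 * Real.toNNReal L⁻¹ : ℝ≥0) : ℝ) * dist x y) := by gcongr
      _ = _ := by ring
  exact hp.max_const 0

lemma gk_supp {p L : ℝ} {k : ℕ} {η : ℝ} (hη : 0 < η) :
    tsupport (gk p L k η) ⊆ {x | |(x 0 - p) / L| ^ (2 * k + 2) ≤ 1 - η} := by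
  refine closure_minimal ?_ (isClosed_le (by fun_prop) (by fun_prop))
  intro x hx
  by_contra h
  apply hx
  simp only [mem_setOf_eq, not_le] at h
  unfold gk
  refine max_eq_right ?_
  by_cases h1 : |(x 0 - p) / L| < 1
  · rw [clip_of_lt h1]
    have he : Even (2 * k + 2) := ⟨k + 1, by ring⟩
    rw [he.pow_abs] at h; linarith
  · have he : Even (2 * k + 2) := ⟨k + 1, by ring⟩
    rw [← he.pow_abs, clip_of_ge (not_lt.1 h1), one_pow]; linarith

lemma gk_grad {p L : ℝ} {k : ℕ} {η : ℝ} (hη : 0 < η) {x : Euc 1}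
    (hx : |(x 0 - p) / L| ^ (2 * k + 2) < 1 - η) :
    ⟪gradient (gk p L k η) x, EuclideanSpace.single 0 1⟫ =
      - ((2 * k + 2) * ((x 0 - p) / L) ^ (2 * k + 1) * L⁻¹) := by
  rw [inner_grad]
  have he : Even (2 * k + 2) := ⟨k + 1, by ring⟩
  have hev : gk p L k η =ᶠ[𝓝 x] fun y => (1 - η) - ((y 0 - p) / L) ^ (2 * k + 2) := by
    have ho : IsOpen {y : Euc 1 | |(y 0 - p) / L| ^ (2 * k + 2) < 1 - η} :=
      isOpen_lt (by fun_prop) (by fun_prop)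
    filter_upwards [ho.mem_nhds hx] with y hy
    have hy' : |(y 0 - p) / L| ^ (2 * k + 2) < 1 - η := hy
    have h1 : |(y 0 - p) / L| < 1 := by
      by_contra h
      have := one_le_pow₀ (n := 2 * k + 2) (not_lt.1 h)
      linarith
    unfold gk
    rw [clip_of_lt h1]
    rw [he.pow_abs] at hy'
    exact max_eq_left (by linarith)
  rw [hev.fderiv_eq]
  have := (((s_deriv p L x).pow (2 * k + 2)).const_sub (1 - η)).fderiv
  rw [this]
  simp

lemma d1_bound (c : Ctx D lam u ν) (hDb : Bornology.IsBounded D) {p L : ℝ} (hL : 0 < L)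
    (hDs : D = {x : Euc 1 | |(x 0 - p) / L| < 1}) :
    ∃ C > 0, ∀ σ, 0 ≤ σ → σ < 1 → ν {x : Euc 1 | |(x 0 - p) / L| ≤ σ} ≤ ENNReal.ofReal C := by
  haveI : IsFiniteMeasure (volume.restrict D) := ⟨by
    rw [Measure.restrict_apply_univ]; exact hDb.measure_lt_top⟩
  have iu : IntegrableOn u D := (c.hm.1.restrict D).integrable (by norm_num)
  have hM : 0 ≤ ∫ x in D, u x := integral_nonneg fun x => c.nn x
  have hl := c.lam0
  have hcomp : ∀ τ : ℝ, τ < 1 → IsCompact {x : Euc 1 | |(x 0 - p) / L| ≤ τ} ∧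
      {x : Euc 1 | |(x 0 - p) / L| ≤ τ} ⊆ D := by
    intro τ hτ
    have hs : {x : Euc 1 | |(x 0 - p) / L| ≤ τ} ⊆ D := by
      rw [hDs]; intro x hx; exact lt_of_le_of_lt hx hτ
    exact ⟨Metric.isCompact_of_isClosed_isBounded (isClosed_le (by fun_prop) (by fun_prop)) (hDb.subset hs), hs⟩
  refine ⟨2 * (lam * ∫ x in D, u x) + 1, by positivity, fun σ hσ0 hσ => ?_⟩
  obtain ⟨k, hk⟩ := exists_pow_lt_of_lt_one (by norm_num : (0 : ℝ) < 1 / 4) hσ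
  have hk' : σ ^ (2 * k + 2) ≤ 1 / 4 := (pow_le_pow_of_le_one hσ0 hσ.le (by omega)).trans hk.le
  set P : Euc 1 → ℝ := fun x => - ((2 * k + 2) * ((x 0 - p) / L) ^ (2 * k + 1) * L⁻¹) with hP
  set Q : Euc 1 → ℝ := fun x => - ((2 * k + 2) * ((2 * k + 1) * ((x 0 - p) / L) ^ (2 * k) * L⁻¹) * L⁻¹) with hQ
  set e : Euc 1 := EuclideanSpace.single 0 1 with he
  have hPd : ∀ x, ∃ F : Euc 1 →L[ℝ] ℝ, HasFDerivAt P F x ∧ F e = Q x := by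
    intro x
    refine ⟨_, ((((s_deriv p L x).pow (2 * k + 1)).const_mul (2 * k + 2 : ℝ)).mul_const L⁻¹).neg, ?_⟩
    simp [hQ, he]
    ring
  have hI : 0 ≤ ∫ x in D, ⟪gradient u x, e⟫ * P x := by
    refine d1_I (Q := Q) c.hm c.hD hDb c.nn (by simp [he]) (fun x => (hPd x).choose_spec.1.differentiableAt) (by fun_prop) ?_ ?_
    · intro x; obtain ⟨F, hF, hF'⟩ := hPd x; rw [hF.fderiv, hF']
    · intro x
      have : 0 ≤ ((x 0 - p) / L) ^ (2 * k) := by rw [pow_mul]; positivity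
      simp only [hQ]
      have : 0 ≤ ((2 * k + 2 : ℝ) * ((2 * k + 1) * ((x 0 - p) / L) ^ (2 * k) * L⁻¹) * L⁻¹) := by positivity
      linarith
  obtain ⟨K, hK⟩ := gk_lip p hL k
  set η : ℕ → ℝ := fun j => 1 / 4 * (1 / ((j : ℝ) + 1)) with hη
  have hη0 : ∀ j, 0 < η j := fun j => by simp only [hη]; positivity
  have hη4 : ∀ j, η j ≤ 1 / 4 := by
    intro j
    have : 1 / ((j : ℝ) + 1) ≤ 1 := by rw [div_le_one (by positivity)]; linarith [(Nat.cast_nonneg j : (0 : ℝ) ≤ j)]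
    simp only [hη]; linarith
  have hηl : Tendsto η atTop (𝓝 0) := by
    have := (tendsto_one_div_add_atTop_nhds_zero_nat (𝕜 := ℝ)).const_mul (1 / 4)
    rwa [mul_zero] at this
  have hsD : ∀ j, tsupport (gk p L k (η j)) ⊆ D := by
    intro j x hx
    have := gk_supp (hη0 j) hx
    simp only [mem_setOf_eq] at this
    rw [hDs, mem_setOf_eq]
    by_contra h
    have h2 := one_le_pow₀ (n := 2 * k + 2) (not_lt.1 h)
    linarith [hη0 j]
  have hsc : ∀ j, HasCompactSupport (gk p L k (η j)) := fun j =>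
    Metric.isCompact_of_isClosed_isBounded (isClosed_tsupport _) (hDb.subset (hsD j))
  have g0 : ∀ j x, 0 ≤ gk p L k (η j) x := fun j x => le_max_right _ _
  have he2 : Even (2 * k + 2) := ⟨k + 1, by ring⟩
  have g1 : ∀ j x, gk p L k (η j) x ≤ 1 := fun j x => max_le (by
    have := he2.pow_nonneg (clip ((x 0 - p) / L)); linarith [hη0 j]) zero_le_one
  set S := {x : Euc 1 | |(x 0 - p) / L| ≤ σ} with hS
  obtain ⟨Sc, SD⟩ := hcomp σ hσ
  have Sfin := c.fin S Sc SD
  have low : ∀ j, 1 / 2 * ν.real S ≤ ∫ x, gk p L k (η j) x ∂ν := by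
    intro j
    have i1 := c.integrable (hK (η j)).continuous (hsc j) (hsD j)
    have : ∫ x, S.indicator (fun _ => (1 / 2 : ℝ)) x ∂ν = 1 / 2 * ν.real S := by
      rw [integral_indicator_const _ Sc.measurableSet]; rw [smul_eq_mul, mul_comm]
    rw [← this]
    refine integral_mono ?_ i1 fun x => ?_
    · rw [integrable_indicator_iff Sc.measurableSet]; exact integrableOn_const Sfin.ne
    · by_cases hx : x ∈ S
      · rw [indicator_of_mem hx]
        have hx' : |(x 0 - p) / L| ≤ σ := hx
        refine le_max_of_le_left ?_
        rw [clip_of_lt (lt_of_le_of_lt hx' hσ), ← he2.pow_abs]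
        have := pow_le_pow_left₀ (abs_nonneg _) hx' (2 * k + 2)
        linarith [hη4 j]
      · rw [indicator_of_notMem hx]; exact g0 j x
  have hrep : ∀ j, ∫ x, gk p L k (η j) x ∂ν ≤ lam * (∫ x in D, u x) -
      ∫ x in D, ⟪gradient u x, gradient (gk p L k (η j)) x⟫ := by
    intro j
    rw [c.rep _ K (hK (η j)) (hsc j) (hsD j)]
    unfold Nf
    have z1 : ∀ x, x ∉ D → gk p L k (η j) x = 0 := fun x hx =>
      image_eq_zero_of_notMem_tsupport fun h => hx (hsD j h)
    have z2 : ∀ x, x ∉ D → gradient (gk p L k (η j)) x = 0 := fun x hx =>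
      gradient_zero_off fun h => hx (hsD j h)
    rw [← setIntegral_eq_integral_of_forall_compl_eq_zero (s := D)
        (f := fun x => u x * gk p L k (η j) x) (fun x hx => by rw [z1 x hx, mul_zero]),
      ← setIntegral_eq_integral_of_forall_compl_eq_zero (s := D)
        (f := fun x => ⟪gradient u x, gradient (gk p L k (η j)) x⟫) (fun x hx => by rw [z2 x hx, inner_zero_right])]
    have : ∫ x in D, u x * gk p L k (η j) x ≤ ∫ x in D, u x := by
      refine integral_mono ?_ iu fun x => ?_
      · exact ((c.hm.1.integrable_mul (memLp_lip (hK (η j)) (hsc j) 2))).integrableOn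
      · exact mul_le_of_le_one_right (c.nn x) (g1 j x)
    have := mul_le_mul_of_nonneg_left this hl
    linarith
  have hlim : Tendsto (fun j => ∫ x in D, ⟪gradient u x, gradient (gk p L k (η j)) x⟫) atTop
      (𝓝 (∫ x in D, ⟪gradient u x, e⟫ * P x)) := by
    refine tendsto_integral_of_dominated_convergence (fun x => ‖gradient u x‖ * K) ?_ ?_ ?_ ?_
    · intro j
      exact ((measurable_gradient u).inner (measurable_gradient _)).aestronglyMeasurable
    · exact (((c.hm.2.1.restrict D).integrable (by norm_num)).norm).mul_const _
    · intro j
      refine Eventually.of_forall fun x => ?_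
      refine (norm_inner_le_norm _ _).trans ?_
      gcongr
      exact norm_gradient_le (hK (η j)) x
    · filter_upwards [ae_restrict_mem c.hD.measurableSet] with x hx
      rw [hDs] at hx
      have hx' : |(x 0 - p) / L| ^ (2 * k + 2) < 1 := pow_lt_one₀ (abs_nonneg _) hx (by omega)
      have hev : ∀ᶠ j in atTop, η j < 1 - |(x 0 - p) / L| ^ (2 * k + 2) :=
        hηl.eventually_lt_const (by linarith)
      refine tendsto_const_nhds.congr' ?_
      filter_upwards [hev] with j hj
      rw [inner_one (gradient u x) (gradient _ x), gk_grad (hη0 j) (by linarith)]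
  have hfin : 1 / 2 * ν.real S ≤ lam * (∫ x in D, u x) - ∫ x in D, ⟪gradient u x, e⟫ * P x :=
    ge_of_tendsto' (tendsto_const_nhds.sub hlim) fun j => (low j).trans (hrep j)
  rw [← ENNReal.ofReal_toReal Sfin.ne]
  refine ENNReal.ofReal_le_ofReal ?_
  have : ν.real S = (ν S).toReal := rfl
  linarith

lemma d1_interval (hD : IsOpen D) (hDb : Bornology.IsBounded D) (hDc : IsConnected D) :
    ∃ p L : ℝ, 0 < L ∧ D = {x : Euc 1 | |(x 0 - p) / L| < 1} := by
  set E : Set ℝ := (fun x : Euc 1 => x 0) '' D with hE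
  have hcon : IsConnected E := hDc.image _ (by fun_prop)
  obtain ⟨C, hC⟩ := hDb.exists_norm_le
  have hEC : ∀ y ∈ E, |y| ≤ C := by
    rintro _ ⟨x, hx, rfl⟩
    exact (PiLp.norm_apply_le x 0).trans (hC x hx)
  have ba : BddAbove E := ⟨C, fun y hy => (abs_le.1 (hEC y hy)).2⟩
  have bb : BddBelow E := ⟨-C, fun y hy => (abs_le.1 (hEC y hy)).1⟩
  have hsub := hcon.Ioo_csInf_csSup_subset bb ba
  have hopen : ∀ y ∈ E, ∃ δ > 0, y + δ ∈ E ∧ y - δ ∈ E := by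
    rintro _ ⟨x, hx, rfl⟩
    obtain ⟨δ, hδ, hb⟩ := Metric.isOpen_iff.1 hD x hx
    refine ⟨δ / 2, by positivity, ⟨x + EuclideanSpace.single 0 (δ / 2), hb ?_, by simp⟩,
      ⟨x - EuclideanSpace.single 0 (δ / 2), hb ?_, by simp⟩⟩
    · rw [mem_ball, dist_eq_norm, add_sub_cancel_left, EuclideanSpace.norm_single, Real.norm_eq_abs,
        abs_of_pos (by positivity)]; linarith
    · rw [mem_ball, dist_eq_norm, sub_sub_cancel_left, norm_neg, EuclideanSpace.norm_single, Real.norm_eq_abs,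
        abs_of_pos (by positivity)]; linarith
  have hEI : ∀ y ∈ E, sInf E < y ∧ y < sSup E := by
    intro y hy
    obtain ⟨δ, hδ, h1, h2⟩ := hopen y hy
    exact ⟨by linarith [csInf_le bb h2], by linarith [le_csSup ba h1]⟩
  obtain ⟨y, hy⟩ := hcon.nonempty
  have hlt := (hEI y hy).1.trans (hEI y hy).2
  have hL : 0 < (sSup E - sInf E) / 2 := by linarith
  refine ⟨(sInf E + sSup E) / 2, (sSup E - sInf E) / 2, hL, ?_⟩
  ext x
  rw [mem_setOf_eq, abs_div, abs_of_pos hL, div_lt_one hL, abs_lt]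
  constructor
  · intro hx
    obtain ⟨h1, h2⟩ := hEI (x 0) ⟨x, hx, rfl⟩
    constructor <;> linarith
  · rintro ⟨h1, h2⟩
    obtain ⟨z, hz, hzx⟩ := hsub ⟨by linarith, by linarith⟩ (a := x 0)
    have : z = x := by ext i; rw [Subsingleton.elim i 0]; exact hzx
    rwa [← this]

lemma d1_upper (c : Ctx D lam u ν) (hDb : Bornology.IsBounded D) (hDc : IsConnected D) :
    ∃ C > 0, ν D ≤ ENNReal.ofReal C := by
  obtain ⟨p, L, hL, hDs⟩ := d1_interval c.hD hDb hDc
  obtain ⟨C, hC, h⟩ := d1_bound c hDb hL hDs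
  refine ⟨C, hC, ?_⟩
  have hU : D = ⋃ j : ℕ, {x : Euc 1 | |(x 0 - p) / L| ≤ 1 - 1 / ((j : ℝ) + 1)} := by
    ext x
    rw [hDs, mem_iUnion]
    simp only [mem_setOf_eq]
    constructor
    · intro hx
      obtain ⟨j, hj⟩ := exists_nat_one_div_lt (sub_pos.2 hx)
      exact ⟨j, by linarith⟩
    · rintro ⟨j, hj⟩
      have : 0 < 1 / ((j : ℝ) + 1) := by positivity
      linarith
  have hmono : Monotone fun j : ℕ => {x : Euc 1 | |(x 0 - p) / L| ≤ 1 - 1 / ((j : ℝ) + 1)} := by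
    intro i j hij x hx
    simp only [mem_setOf_eq] at hx ⊢
    have := Nat.one_div_le_one_div (α := ℝ) hij
    linarith
  rw [hU, hmono.measure_iUnion]
  refine iSup_le fun j => h _ ?_ ?_
  · have : 1 / ((j : ℝ) + 1) ≤ 1 := by rw [div_le_one (by positivity)]; linarith [(Nat.cast_nonneg j : (0 : ℝ) ≤ j)]
    linarith
  · have : 0 < 1 / ((j : ℝ) + 1) := by positivity
    linarith

end d1b

end part11

/-- Ahlfors-type bounds for `ν = Δu + λ_a u`: there are `C₁, C₂, r₀ > 0` such
that for every ball `B(x₀,r) ⊆ B` with `x₀ ∈ ∂Ω_u` and `r ≤ r₀`,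
`C₁ r^{d-1} ≤ ν(B(x₀,r)) ≤ C₂ r^{d-1}`. -/
theorem boundary_measure_bounds
    {d : ℕ} (D : Set (Euc d)) (a lama R : ℝ) (xc : Euc d) (u : Euc d → ℝ)
    (ν : Measure (Euc d))
    (hD : IsOpen D) (hDb : Bornology.IsBounded D) (hDc : IsConnected D)
    (ha : 0 < a) (ha' : a < mvol D)
    (hlam : lama = lamOpt D a) (hu : IsJMinimizer D a lama u)
    (hnn : ∀ x, 0 ≤ u x) (hlip : LocLipOn D u)
    (hν : ∀ φ : Euc d → ℝ, TestFun D φ →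
      (∫ x, φ x ∂ν) = lama * (∫ x, u x * φ x) - ∫ x, ⟪gradient u x, gradient φ x⟫)
    (hR : 0 < R) (hball : ball xc R ⊆ D) (hxc : xc ∈ frontier (Om D u) ∩ D)
    (hpen : ∃ Λ > (0 : ℝ), ∃ h₀ > (0 : ℝ), ∀ h : ℝ, 0 < h → h < h₀ →
      (Mplus D a lama u (ball xc R) h).Nonempty ∧
      0 < muMinus D a lama u (ball xc R) h ∧
      muMinus D a lama u (ball xc R) h ≤ Λ ∧ Λ ≤ muPlus D a lama u (ball xc R) h) :
    ∃ C₁ > (0 : ℝ), ∃ C₂ > (0 : ℝ), ∃ r₀ > (0 : ℝ),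
      ∀ (x₀ : Euc d) (r : ℝ), x₀ ∈ frontier (Om D u) → 0 < r → r ≤ r₀ →
        ball x₀ r ⊆ ball xc R →
        ENNReal.ofReal (C₁ * r ^ ((d : ℝ) - 1)) ≤ ν (ball x₀ r) ∧
        ν (ball x₀ r) ≤ ENNReal.ofReal (C₂ * r ^ ((d : ℝ) - 1)) := by
  have hlam0 : 0 ≤ lama := by
    rw [hlam]
    refine Real.sInf_nonneg ?_
    rintro t ⟨Ω, -, -, -, rfl⟩
    refine Real.sInf_nonneg ?_
    rintro t ⟨v, -, -, rfl⟩
    exact integral_nonneg fun x => by positivity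
  rcases Nat.eq_zero_or_pos d with rfl | hd
  · exfalso
    have hc : frontier (Om D u) = ∅ := isClopen_iff_frontier_eq_empty.1 (isClopen_discrete _)
    have := hxc.1
    rw [hc] at this
    exact this
  obtain ⟨Λ, hΛ, h₀, hh₀, hp⟩ := hpen
  obtain ⟨⟨μp, hμp⟩, hpos, -, -⟩ := hp (h₀ / 2) (by positivity) (by linarith)
  have hex : ∃ μm ∈ Mminus D a lama u (ball xc R) (h₀ / 2), 0 < μm := by
    by_contra hcon
    push Not at hcon
    exact absurd (Real.sSup_nonpos hcon) (not_le.2 hpos)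
  obtain ⟨μm, hμm, hμm0⟩ := hex
  have c := mk_ctx2 hd hD hDb hlam0 hu hnn hlip hν hball hxc (by positivity : 0 < h₀ / 2) hμp hμm hμm0
  obtain ⟨C₁, hC₁, r₁, hr₁, hlow⟩ := c.lower
  have hup : ∃ C₂ > 0, ∃ r₀ > 0, ∀ (x₀ : Euc d) (r : ℝ),
      0 < r → r ≤ r₀ → ball x₀ r ⊆ ball xc R →
      ν (ball x₀ r) ≤ ENNReal.ofReal (C₂ * r ^ (d - 1)) := by
    by_cases hd2 : 2 ≤ d
    · exact c.upper_ge2 hR hd2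
    · have hd1 : d = 1 := by omega
      subst hd1
      obtain ⟨C, hC, hCD⟩ := d1_upper c.toCtx hDb hDc
      refine ⟨C, hC, 1, one_pos, fun x₀ r _ _ hb => ?_⟩
      rw [Nat.sub_self, pow_zero, mul_one]
      exact (measure_mono (hb.trans hball)).trans hCD
  obtain ⟨C₂, hC₂, r₂, hr₂, hupp⟩ := hup
  refine ⟨C₁, hC₁, C₂, hC₂, min r₁ r₂, lt_min hr₁ hr₂, ?_⟩
  intro x₀ r hx hr hrr hb
  have hpow : r ^ ((d : ℝ) - 1) = r ^ (d - 1) := by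
    rw [← Real.rpow_natCast, Nat.cast_pred hd]
  rw [hpow]
  exact ⟨hlow x₀ r hx hr (hrr.trans (min_le_left _ _)) hb,
    hupp x₀ r hr (hrr.trans (min_le_right _ _)) hb⟩

end
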